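/- arXiv:2504.06865 — 5 statements merged into one kernel-verified Lean document; each statement's English description precedes it below -/
import Mathlib

section
/- Let (X,d) be a compact (R,D)-thin metric space. Let l : [0,Λ] → X be a segment of maximal length in X (every segment in X has length ≤ Λ) and assume Λ ≥ 200R. If X is not contained in the 200R-neighbourhood of l([0,Λ]) (i.e. some point of X has distance ≥ 200R from l([0,Λ])), then there exist L ≥ 50R and a distance-preserving map φ : S¹_L → X, where S¹_L is the circle of circumference 2πL (the quotient ℝ/(2πL)ℤ with the quotient arc-length metric d(x,y) = min_{k∈ℤ} |x − y − 2πLk|), such that X is contained in the D-neighbourhood of φ(S¹_L): dist(x, φ(S¹_L)) < D for every x ∈ X. -/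
open Metric Set

/-- `l` restricted to `[a, b]` is a unit-speed segment (isometric embedding of `[a,b]`). -/
def IsSegmentOn {X : Type*} [PseudoMetricSpace X] (l : ℝ → X) (a b : ℝ) : Prop :=
  ∀ s ∈ Set.Icc a b, ∀ t ∈ Set.Icc a b, dist (l s) (l t) = |s - t|

/-- A ray in `X`: an isometric embedding of `[0, ∞)`. -/
def IsRay {X : Type*} [PseudoMetricSpace X] (r : ℝ → X) : Prop :=
  ∀ s t : ℝ, 0 ≤ s → 0 ≤ t → dist (r s) (r t) = |s - t|

/-- `X` is a geodesic space: any two points are joined by a segment. -/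
def IsGeodesicSpace (X : Type*) [PseudoMetricSpace X] : Prop :=
  ∀ x y : X, ∃ f : ℝ → X, IsSegmentOn f 0 (dist x y) ∧ f 0 = x ∧ f (dist x y) = y

/-- The metric projection of a point `x` to a set `K`:
the set of points of `K` realizing the distance from `x` to `K`. -/
def metricProj {X : Type*} [PseudoMetricSpace X] (K : Set X) (x : X) : Set X :=
  {y ∈ K | dist x y = Metric.infDist x K}

/-- The metric projection of a set `A` to a set `K`. -/
def metricProjSet {X : Type*} [PseudoMetricSpace X] (K A : Set X) : Set X :=
  ⋃ x ∈ A, metricProj K x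

/-- `S` contains a `c`-net of `T`: every point of `T` is within distance `c` of `S`. -/
def ContainsNetOf {X : Type*} [PseudoMetricSpace X] (S T : Set X) (c : ℝ) : Prop :=
  ∀ p ∈ T, ∃ q ∈ S, dist p q ≤ c

/-- An `(R,D)`-thin metric space: a proper, separable, geodesic metric space
(with `R ≥ 20 D > 0`) such that for every segment `l` of length `L > 2R`, every
`t ∈ (R, L - R)` and every `x` whose projection to `l` meets `l(t)`, one has
`dist(x, l) < D`. -/
structure IsThinSpace (X : Type*) [MetricSpace X] (R D : ℝ) : Prop where
  R_pos : 0 < R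
  D_pos : 0 < D
  twentyD_le_R : 20 * D ≤ R
  proper : ProperSpace X
  separable : TopologicalSpace.SeparableSpace X
  geodesic : IsGeodesicSpace X
  thin : ∀ (l : ℝ → X) (L : ℝ), 2 * R < L → IsSegmentOn l 0 L →
    ∀ t ∈ Set.Ioo R (L - R), ∀ x : X,
      dist x (l t) = Metric.infDist x (l '' Set.Icc 0 L) →
      Metric.infDist x (l '' Set.Icc 0 L) < D

/-- `Γ : [0, ℓ] → X × ℝ` is a 1-Lipschitz curve whose second coordinate lifts the values of `G`
along its first coordinate. -/
structure IsLiftedPath {X : Type*} [MetricSpace X] {κ : ℝ} (G : X → AddCircle κ)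
    (Γ : ℝ → X × ℝ) (ℓ : ℝ) : Prop where
  dist_le : ∀ s t, 0 ≤ s → s ≤ t → t ≤ ℓ → dist (Γ s) (Γ t) ≤ t - s
  lift : ∀ s, 0 ≤ s → s ≤ ℓ → G (Γ s).1 = ((Γ s).2 : AddCircle κ)

/-- The points `p` and `q` of the cover of `X` induced by `G` are joined by a lifted path of
length `ℓ`. -/
def LiftReach {X : Type*} [MetricSpace X] {κ : ℝ} (G : X → AddCircle κ)
    (p q : X × ℝ) (ℓ : ℝ) : Prop :=
  0 ≤ ℓ ∧ ∃ Γ, IsLiftedPath G Γ ℓ ∧ Γ 0 = p ∧ Γ ℓ = q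

section LiftedPaths

variable {X : Type*} [MetricSpace X] {κ : ℝ} {G : X → AddCircle κ}

theorem IsLiftedPath.liftReach {Γ : ℝ → X × ℝ} {ℓ a b : ℝ} (h : IsLiftedPath G Γ ℓ)
    (ha : 0 ≤ a) (hab : a ≤ b) (hb : b ≤ ℓ) : LiftReach G (Γ a) (Γ b) (b - a) := by
  refine ⟨by linarith, fun t => Γ (a + t), ⟨fun s t hs hst ht => ?_, fun s hs hs' => ?_⟩, ?_, ?_⟩
  · have := h.dist_le (a + s) (a + t) (by linarith) (by linarith) (by linarith)
    linarith
  · exact h.lift _ (by linarith) (by linarith)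
  · simp
  · simp

theorem LiftReach.trans {p q r : X × ℝ} {ℓ m : ℝ} (h₁ : LiftReach G p q ℓ)
    (h₂ : LiftReach G q r m) : LiftReach G p r (ℓ + m) := by
  obtain ⟨hℓ, Γ, hΓ, hΓ0, hΓ1⟩ := h₁
  obtain ⟨hm, Δ, hΔ, hΔ0, hΔ1⟩ := h₂
  refine ⟨by linarith, fun t => if t ≤ ℓ then Γ t else Δ (t - ℓ),
    ⟨fun s t hs hst ht => ?_, fun s hs hs' => ?_⟩, ?_, ?_⟩
  · by_cases h1 : t ≤ ℓ
    · simp only [h1, hst.trans h1, if_true]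
      exact hΓ.dist_le s t hs hst h1
    · by_cases h2 : s ≤ ℓ
      · simp only [h1, h2, if_true, if_false]
        have e1 := hΓ.dist_le s ℓ hs h2 le_rfl
        have e2 := hΔ.dist_le 0 (t - ℓ) le_rfl (by linarith) (by linarith)
        rw [hΓ1] at e1
        rw [hΔ0] at e2
        linarith [dist_triangle (Γ s) q (Δ (t - ℓ))]
      · simp only [h1, h2, if_false]
        have := hΔ.dist_le (s - ℓ) (t - ℓ) (by linarith) (by linarith) (by linarith)
        linarith
  · by_cases h2 : s ≤ ℓ
    · simp only [h2, if_true]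
      exact hΓ.lift s hs h2
    · simp only [h2, if_false]
      exact hΔ.lift _ (by linarith) (by linarith)
  · simp [hℓ, hΓ0]
  · by_cases h : ℓ + m ≤ ℓ
    · have hm0 : m = 0 := by linarith
      subst hm0
      simp [hΓ1, ← hΔ1, hΔ0]
    · simp only [h, if_false]
      rw [add_sub_cancel_left, hΔ1]

theorem LiftReach.symm {p q : X × ℝ} {ℓ : ℝ} (h : LiftReach G p q ℓ) : LiftReach G q p ℓ := by
  obtain ⟨hℓ, Γ, hΓ, hΓ0, hΓ1⟩ := h
  refine ⟨hℓ, fun t => Γ (ℓ - t), ⟨fun s t hs hst ht => ?_, fun s hs hs' => ?_⟩, ?_, ?_⟩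
  · have := hΓ.dist_le (ℓ - t) (ℓ - s) (by linarith) (by linarith) (by linarith)
    rw [dist_comm]
    linarith
  · exact hΓ.lift _ (by linarith) (by linarith)
  · simp [hΓ1]
  · simp [hΓ0]

theorem LiftReach.shift {p q : X × ℝ} {ℓ c : ℝ} (h : LiftReach G p q ℓ)
    (hc : (c : AddCircle κ) = 0) : LiftReach G (p.1, p.2 + c) (q.1, q.2 + c) ℓ := by
  obtain ⟨hℓ, Γ, hΓ, hΓ0, hΓ1⟩ := h
  refine ⟨hℓ, fun t => ((Γ t).1, (Γ t).2 + c),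
    ⟨fun s t hs hst ht => ?_, fun s hs hs' => ?_⟩, ?_, ?_⟩
  · have := hΓ.dist_le s t hs hst ht
    rw [Prod.dist_eq] at this ⊢
    simpa using this
  · rw [AddCircle.coe_add, hc, add_zero]
    exact hΓ.lift s hs hs'
  · simp [hΓ0]
  · simp [hΓ1]

theorem LiftReach.lift_left {p q : X × ℝ} {ℓ : ℝ} (h : LiftReach G p q ℓ) :
    G p.1 = (p.2 : AddCircle κ) := by
  obtain ⟨hℓ, Γ, hΓ, rfl, -⟩ := h
  exact hΓ.lift 0 le_rfl hℓ

theorem LiftReach.lift_right {p q : X × ℝ} {ℓ : ℝ} (h : LiftReach G p q ℓ) :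
    G q.1 = (q.2 : AddCircle κ) :=
  h.symm.lift_left

theorem le_abs_sub_of_coe_eq {s t : ℝ} (hκ : 0 < κ) (h : (s : AddCircle κ) = t) (hne : s ≠ t) :
    κ ≤ |s - t| := by
  have h0 : ((s - t : ℝ) : AddCircle κ) = 0 := by rw [AddCircle.coe_sub, h, sub_self]
  obtain ⟨n, hn⟩ := (AddCircle.coe_eq_zero_iff κ).1 h0
  rw [← hn, zsmul_eq_mul, abs_mul, abs_of_pos hκ]
  have hn0 : n ≠ 0 := by
    rintro rfl
    exact hne (sub_eq_zero.1 (by simpa using hn.symm))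
  have : (1 : ℝ) ≤ |(n : ℝ)| := by exact_mod_cast Int.one_le_abs hn0
  nlinarith

/-- A function that is 1-Lipschitz at small scale on an interval is 1-Lipschitz on it. -/
theorem abs_sub_le_of_local {f : ℝ → ℝ} {ℓ D : ℝ} (hD : 0 < D)
    (hf : ∀ s t, 0 ≤ s → s ≤ t → t ≤ ℓ → t - s < D → |f s - f t| ≤ t - s)
    {s t : ℝ} (hs : 0 ≤ s) (hst : s ≤ t) (ht : t ≤ ℓ) : |f s - f t| ≤ t - s := by
  have key : ∀ n : ℕ, ∀ s t, 0 ≤ s → s ≤ t → t ≤ ℓ → t - s ≤ n * (D / 2) →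
      |f s - f t| ≤ t - s := by
    intro n
    induction n with
    | zero =>
      intro s t hs hst ht h
      exact hf s t hs hst ht (by simp at h; linarith)
    | succ k ih =>
      intro s t hs hst ht h
      by_cases hsm : t - s < D
      · exact hf s t hs hst ht hsm
      · push_cast at h
        have h1 := ih s (t - D / 2) hs (by linarith) (by linarith) (by linarith)
        have h2 := hf (t - D / 2) t (by linarith) (by linarith) ht (by linarith)
        have := abs_sub_le (f s) (f (t - D / 2)) (f t)
        linarith
  obtain ⟨n, hn⟩ := exists_nat_gt ((t - s) / (D / 2))
  rw [div_lt_iff₀ (by positivity)] at hn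
  exact key n s t hs hst ht hn.le

/-- A segment along which a real function lifts `G` and is 1-Lipschitz at small scale
gives a lifted path. -/
theorem liftReach_of_segment {σ : ℝ → X} {f : X → ℝ} {ℓ D : ℝ} (hD : 0 < D) (hℓ : 0 ≤ ℓ)
    (hσ : IsSegmentOn σ 0 ℓ) (hG : ∀ t ∈ Icc 0 ℓ, G (σ t) = (f (σ t) : AddCircle κ))
    (hf : ∀ s ∈ Icc 0 ℓ, ∀ t ∈ Icc 0 ℓ, dist (σ s) (σ t) < D →
      |f (σ s) - f (σ t)| ≤ dist (σ s) (σ t)) :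
    LiftReach G (σ 0, f (σ 0)) (σ ℓ, f (σ ℓ)) ℓ := by
  have hd : ∀ s t, 0 ≤ s → s ≤ t → t ≤ ℓ → dist (σ s) (σ t) = t - s := by
    intro s t hs hst ht
    rw [hσ s ⟨hs, hst.trans ht⟩ t ⟨hs.trans hst, ht⟩, abs_sub_comm, abs_of_nonneg (by linarith)]
  refine ⟨hℓ, fun t => (σ t, f (σ t)), ⟨fun s t hs hst ht => ?_, fun s hs hs' => ?_⟩, rfl, rfl⟩
  · rw [Prod.dist_eq]
    refine max_le (hd s t hs hst ht).le ?_
    rw [Real.dist_eq]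
    refine abs_sub_le_of_local (f := fun t => f (σ t)) hD (fun s t hs hst ht hlt => ?_) hs hst ht
    have e := hd s t hs hst ht
    rw [← e] at hlt ⊢
    exact hf s ⟨hs, hst.trans ht⟩ t ⟨hs.trans hst, ht⟩ hlt
  · exact hG s ⟨hs, hs'⟩

/-- If nearby points can be joined by lifted paths, so can all points of a geodesic space. -/
theorem exists_liftReach_of_local (hX : IsGeodesicSpace X) {D : ℝ} (hD : 0 < D)
    (hloc : ∀ y z : X, ∀ s : ℝ, dist y z < D → G y = (s : AddCircle κ) →
      ∃ t, LiftReach G (y, s) (z, t) (dist y z))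
    (y z : X) (s : ℝ) (hs : G y = (s : AddCircle κ)) :
    ∃ t, LiftReach G (y, s) (z, t) (dist y z) := by
  have key : ∀ n : ℕ, ∀ y z : X, ∀ s : ℝ, dist y z ≤ n * (D / 2) → G y = (s : AddCircle κ) →
      ∃ t, LiftReach G (y, s) (z, t) (dist y z) := by
    intro n
    induction n with
    | zero =>
      intro y z s h hs
      exact hloc y z s (by simp at h; simpa [h] using hD) hs
    | succ k ih =>
      intro y z s h hs
      by_cases hsm : dist y z < D
      · exact hloc y z s hsm hs
      · obtain ⟨σ, hσ, hσ0, hσ1⟩ := hX y z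
        push_cast at h
        set d := dist y z with hd
        have e1 : dist y (σ (D / 2)) = D / 2 := by
          rw [← hσ0, hσ 0 ⟨le_rfl, by linarith⟩ (D / 2) ⟨by linarith, by linarith⟩, zero_sub,
            abs_neg, abs_of_pos (by linarith)]
        have e2 : dist (σ (D / 2)) z = d - D / 2 := by
          rw [← hσ1, hσ (D / 2) ⟨by linarith, by linarith⟩ d ⟨by linarith, le_rfl⟩, abs_sub_comm,
            abs_of_nonneg (by linarith)]
        obtain ⟨t, ht⟩ := hloc y (σ (D / 2)) s (by linarith) hs
        obtain ⟨t', ht'⟩ := ih (σ (D / 2)) z t (by rw [e2]; linarith) ht.lift_right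
        refine ⟨t', ?_⟩
        have := ht.trans ht'
        rwa [e1, e2, add_sub_cancel] at this
  obtain ⟨n, hn⟩ := exists_nat_gt (dist y z / (D / 2))
  rw [div_lt_iff₀ (by positivity)] at hn
  exact key n y z s hn.le hs

/-- Among the lifted paths that project to loops but do not close up, there is a shortest one. -/
theorem exists_shortest_essential_loop [CompactSpace X] (hκ : 0 < κ) (hG : Continuous G)
    {p q : X × ℝ} {ℓ : ℝ} (hpq : LiftReach G p q ℓ) (h1 : p.1 = q.1) (h2 : p.2 ≠ q.2) :
    ∃ K Γ, 0 < K ∧ IsLiftedPath G Γ K ∧ (Γ 0).1 = (Γ K).1 ∧ κ ≤ |(Γ 0).2 - (Γ K).2| ∧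
      ∀ p q ℓ, LiftReach G p q ℓ → p.1 = q.1 → p.2 ≠ q.2 → K ≤ ℓ := by
  let T : Set (ℝ × (unitInterval → X × ℝ)) :=
    {c | (∀ s t, dist (c.2 s) (c.2 t) ≤ c.1 * dist s t) ∧
      (∀ s, G (c.2 s).1 = ((c.2 s).2 : AddCircle κ)) ∧ (c.2 0).1 = (c.2 1).1 ∧
      κ ≤ |(c.2 0).2 - (c.2 1).2| ∧ 0 ≤ (c.2 0).2 ∧ (c.2 0).2 ≤ κ}
  have hTpos : ∀ c ∈ T, κ ≤ c.1 := by
    rintro c ⟨hc, -, -, hc', -⟩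
    have := hc 0 1
    have h01 : dist (0 : unitInterval) 1 = 1 := by simp [Subtype.dist_eq]
    rw [h01, mul_one, Prod.dist_eq] at this
    exact hc'.trans ((le_max_right _ _).trans this)
  have hTmem : ∀ p q ℓ, LiftReach G p q ℓ → p.1 = q.1 → p.2 ≠ q.2 → ∃ c ∈ T, c.1 = ℓ := by
    intro p q ℓ hpq h1 h2
    obtain ⟨n, hn, -⟩ := existsUnique_add_zsmul_mem_Ico hκ p.2 0
    have hn0 : ((n • κ : ℝ) : AddCircle κ) = 0 := (AddCircle.coe_eq_zero_iff κ).2 ⟨n, rfl⟩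
    have hsh := hpq.shift hn0
    have hle : κ ≤ |p.2 - q.2| :=
      le_abs_sub_of_coe_eq hκ (by rw [← hpq.lift_left, ← hpq.lift_right, h1]) h2
    obtain ⟨hℓ, Γ, hΓ, hΓ0, hΓ1⟩ := hsh
    refine ⟨(ℓ, fun s => Γ (ℓ * s)), ⟨fun s t => ?_, fun s => ?_, ?_, ?_, ?_, ?_⟩, rfl⟩
    · wlog hst : s ≤ t generalizing s t
      · rw [dist_comm, dist_comm s t]
        exact this t s (le_of_not_ge hst)
      · have hst' : (s : ℝ) ≤ t := hst
        have := hΓ.dist_le (ℓ * s) (ℓ * t) (mul_nonneg hℓ s.2.1)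
          (mul_le_mul_of_nonneg_left hst' hℓ) (by nlinarith [t.2.2])
        rw [Subtype.dist_eq, Real.dist_eq, abs_sub_comm, abs_of_nonneg (by linarith)]
        simp only at this ⊢
        linarith
    · exact hΓ.lift _ (mul_nonneg hℓ s.2.1) (by nlinarith [s.2.2])
    · simp [hΓ0, hΓ1, h1]
    · simpa [hΓ0, hΓ1] using hle
    · simpa [hΓ0] using hn.1
    · simpa [hΓ0] using hn.2.le
  have hTc : IsClosed T := by
    have ev : ∀ s : unitInterval,
        Continuous fun c : ℝ × (unitInterval → X × ℝ) => c.2 s := fun s =>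
      (continuous_apply s).comp continuous_snd
    refine IsClosed.and ?_ (IsClosed.and ?_ (IsClosed.and ?_ (IsClosed.and ?_
      (IsClosed.and ?_ ?_))))
    · simp only [ofPred_forall]
      exact isClosed_iInter fun s => isClosed_iInter fun t =>
        isClosed_le ((ev s).dist (ev t)) (continuous_fst.mul continuous_const)
    · simp only [ofPred_forall]
      exact isClosed_iInter fun s => isClosed_eq (hG.comp (continuous_fst.comp (ev s)))
        ((AddCircle.continuous_mk' κ).comp (continuous_snd.comp (ev s)))
    · exact isClosed_eq (continuous_fst.comp (ev 0)) (continuous_fst.comp (ev 1))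
    · exact isClosed_le continuous_const
        ((continuous_snd.comp (ev 0)).sub (continuous_snd.comp (ev 1))).abs
    · exact isClosed_le continuous_const (continuous_snd.comp (ev 0))
    · exact isClosed_le (continuous_snd.comp (ev 0)) continuous_const
  obtain ⟨c₀, hc₀, hc₀ℓ⟩ := hTmem p q ℓ hpq h1 h2
  have hTcpt : IsCompact (T ∩ {c | c.1 ≤ ℓ}) := by
    refine IsCompact.of_isClosed_subset (s := Icc (0 : ℝ) ℓ ×ˢ
      (Set.pi univ fun _ : unitInterval => (univ : Set X) ×ˢ Icc (-ℓ) (κ + ℓ)))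
      (isCompact_Icc.prod (isCompact_univ_pi fun _ => isCompact_univ.prod isCompact_Icc))
      (hTc.inter (isClosed_le continuous_fst continuous_const)) ?_
    rintro c ⟨hc, hcℓ⟩
    have hpos := hTpos c hc
    obtain ⟨hlip, -, -, -, h0, h0'⟩ := hc
    refine ⟨⟨by linarith, hcℓ⟩, fun s _ => ⟨mem_univ _, ?_⟩⟩
    have h3 := hlip 0 s
    have h4 : dist (0 : unitInterval) s ≤ 1 := by
      rw [Subtype.dist_eq, Real.dist_eq]
      simpa [abs_of_nonneg s.2.1] using s.2.2
    have h5 : |(c.2 0).2 - (c.2 s).2| ≤ c.1 * dist 0 s := by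
      rw [Prod.dist_eq] at h3
      exact (le_max_right _ _).trans h3
    have h6 : c.1 * dist 0 s ≤ ℓ := by
      have : c.1 ≤ ℓ := hcℓ
      nlinarith
    have := abs_le.1 (h5.trans h6)
    constructor <;> linarith [this.1, this.2]
  obtain ⟨c, ⟨hcT, hcℓ⟩, hmin⟩ := hTcpt.exists_isMinOn ⟨c₀, hc₀, hc₀ℓ.le⟩
    (continuous_fst.continuousOn)
  have hK : 0 < c.1 := hκ.trans_le (hTpos c hcT)
  obtain ⟨hlip, hlift, hcl, hge, -, -⟩ := hcT
  have hp0 : projIcc (0 : ℝ) 1 zero_le_one (0 / c.1) = 0 := by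
    simp
  have hp1 : projIcc (0 : ℝ) 1 zero_le_one (c.1 / c.1) = 1 := by
    rw [div_self hK.ne']
    simp
  refine ⟨c.1, fun t => c.2 (projIcc 0 1 zero_le_one (t / c.1)), hK,
    ⟨fun s t hs hst ht => ?_, fun s hs hs' => hlift _⟩, ?_, ?_, ?_⟩
  · refine (hlip _ _).trans ?_
    have hs1 : s / c.1 ∈ Icc (0 : ℝ) 1 :=
      ⟨by positivity, (div_le_one hK).2 (hst.trans ht)⟩
    have ht1 : t / c.1 ∈ Icc (0 : ℝ) 1 :=
      ⟨div_nonneg (hs.trans hst) hK.le, (div_le_one hK).2 ht⟩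
    rw [projIcc_of_mem _ hs1, projIcc_of_mem _ ht1, Subtype.dist_eq, Real.dist_eq, ← sub_div,
      abs_div, abs_of_pos hK, mul_div_cancel₀ _ hK.ne', abs_sub_comm,
      abs_of_nonneg (by linarith)]
  · simpa only [hp0, hp1] using hcl
  · simpa only [hp0, hp1] using hge
  · intro p q m hpq h1 h2
    by_cases hm : m ≤ ℓ
    · obtain ⟨c', hc', rfl⟩ := hTmem p q m hpq h1 h2
      exact hmin ⟨hc', hm⟩
    · exact le_trans hcℓ (le_of_not_ge hm)

/-- A shortest essential loop is an isometrically embedded circle. -/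
theorem dist_eq_of_shortest_essential_loop
    (hlift : ∀ (y z : X) (s : ℝ), G y = (s : AddCircle κ) →
      ∃ t, LiftReach G (y, s) (z, t) (dist y z))
    {K : ℝ} {Γ : ℝ → X × ℝ} (hΓ : IsLiftedPath G Γ K) (h0 : (Γ 0).1 = (Γ K).1)
    (hne : (Γ 0).2 ≠ (Γ K).2)
    (hmin : ∀ p q ℓ, LiftReach G p q ℓ → p.1 = q.1 → p.2 ≠ q.2 → K ≤ ℓ)
    {a b : ℝ} (ha : 0 ≤ a) (hab : a ≤ b) (hb : b ≤ K) :
    dist (Γ a).1 (Γ b).1 = min (b - a) (K - (b - a)) := by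
  have hfst : ∀ s t, 0 ≤ s → s ≤ t → t ≤ K → dist (Γ s).1 (Γ t).1 ≤ t - s := by
    intro s t hs hst ht
    have := hΓ.dist_le s t hs hst ht
    rw [Prod.dist_eq] at this
    exact (le_max_left _ _).trans this
  apply le_antisymm
  · refine le_min (hfst a b ha hab hb) ?_
    have e1 := hfst 0 a le_rfl ha (hab.trans hb)
    have e2 := hfst b K (ha.trans hab) hb le_rfl
    rw [h0, dist_comm] at e1
    rw [dist_comm] at e2
    linarith [dist_triangle (Γ a).1 (Γ K).1 (Γ b).1]
  · obtain ⟨t, ht⟩ := hlift (Γ a).1 (Γ b).1 (Γ a).2 (hΓ.lift a ha (hab.trans hb))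
    by_cases h : t = (Γ b).2
    · subst h
      have e := ((hΓ.liftReach le_rfl ha (hab.trans hb)).trans ht).trans
        (hΓ.liftReach (ha.trans hab) hb le_rfl)
      have := hmin _ _ _ e h0 hne
      exact (min_le_left _ _).trans (by linarith)
    · have e := (hΓ.liftReach ha hab hb).symm.trans ht
      have := hmin _ _ _ e rfl (Ne.symm h)
      exact (min_le_right _ _).trans (by linarith)

end LiftedPaths

theorem AddCircle.norm_coe_eq_min {K t : ℝ} (h0 : 0 ≤ t) (h1 : t ≤ K) :
    ‖(t : AddCircle K)‖ = min t (K - t) := by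
  rcases h0.eq_or_lt with rfl | h0
  · simp [h1]
  have hK : 0 < K := h0.trans_le h1
  by_cases h : t ≤ K / 2
  · rw [(AddCircle.norm_coe_eq_abs_iff K hK.ne').2 (by rwa [abs_of_pos h0, abs_of_pos hK]),
      abs_of_pos h0, min_eq_left (by linarith)]
  · have e : (t : AddCircle K) = ((t - K : ℝ) : AddCircle K) := by
      rw [AddCircle.coe_sub, AddCircle.coe_period, sub_zero]
    rw [e, (AddCircle.norm_coe_eq_abs_iff K hK.ne').2
      (by rw [abs_of_pos hK, abs_of_nonpos (by linarith)]; linarith),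
      abs_of_nonpos (by linarith), min_eq_right (by linarith)]
    ring

theorem exists_isometry_addCircle {X : Type*} [MetricSpace X] {K : ℝ} (hK : 0 < K) {γ : ℝ → X}
    (hγ : ∀ a b, 0 ≤ a → a ≤ b → b ≤ K → dist (γ a) (γ b) = min (b - a) (K - (b - a))) :
    ∃ φ : AddCircle K → X, Isometry φ := by
  have : Fact (0 < K) := ⟨hK⟩
  refine ⟨fun x => γ (AddCircle.equivIco K 0 x), Isometry.of_dist_eq fun x y => ?_⟩
  wlog h : (AddCircle.equivIco K 0 x : ℝ) ≤ AddCircle.equivIco K 0 y generalizing x y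
  · rw [dist_comm, dist_comm x y]
    exact this y x (le_of_not_ge h)
  have hx := (AddCircle.equivIco K 0 x).2
  have hy := (AddCircle.equivIco K 0 y).2
  have ex : x = ((AddCircle.equivIco K 0 x : ℝ) : AddCircle K) :=
    ((AddCircle.equivIco K 0).symm_apply_apply x).symm
  have ey : y = ((AddCircle.equivIco K 0 y : ℝ) : AddCircle K) :=
    ((AddCircle.equivIco K 0).symm_apply_apply y).symm
  rw [hγ _ _ hx.1 h (by linarith [hy.2])]
  conv_rhs => rw [dist_comm, dist_eq_norm, ex, ey, ← AddCircle.coe_sub]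
  rw [AddCircle.norm_coe_eq_min (by linarith) (by linarith [hy.2, hx.1])]

/-- A thin space lies in the `D`-neighbourhood of every long isometrically embedded circle. -/
theorem IsThinSpace.infDist_range_lt {X : Type*} [MetricSpace X] {R D : ℝ}
    (hX : IsThinSpace X R D) {K : ℝ} (hK : 4 * R < K) {φ : AddCircle K → X} (hφ : Isometry φ)
    (x : X) : infDist x (range φ) < D := by
  have hR := hX.R_pos
  have hKpos : 0 < K := by linarith
  have : Fact (0 < K) := ⟨hKpos⟩
  obtain ⟨_, ⟨θ, rfl⟩, hθ⟩ :=
    (isCompact_range hφ.continuous).exists_infDist_eq_dist (range_nonempty φ) x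
  let r : ℝ → X := fun t => φ (θ + ((t - K / 4 : ℝ) : AddCircle K))
  have hr : IsSegmentOn r 0 (K / 2) := by
    intro s hs t ht
    simp only [r]
    rw [hφ.dist_eq, dist_add_left, dist_eq_norm, ← AddCircle.coe_sub, sub_sub_sub_cancel_right]
    refine (AddCircle.norm_coe_eq_abs_iff K hKpos.ne').2 ?_
    rw [abs_of_pos hKpos, abs_le]
    constructor <;> linarith [hs.1, hs.2, ht.1, ht.2]
  have hr0 : r (K / 4) = φ θ := by simp [r]
  have hmem : r (K / 4) ∈ r '' Icc 0 (K / 2) :=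
    mem_image_of_mem _ ⟨by linarith, by linarith⟩
  have hle : infDist x (range φ) ≤ infDist x (r '' Icc 0 (K / 2)) :=
    infDist_le_infDist_of_subset (by rintro _ ⟨t, -, rfl⟩; exact mem_range_self _) ⟨_, hmem⟩
  refine hle.trans_lt (hX.thin r (K / 2) (by linarith) hr (K / 4)
    ⟨by linarith, by linarith⟩ x (le_antisymm ?_ (infDist_le_dist_of_mem hmem)))
  rw [hr0, ← hθ]
  exact hle

/-- The distance to `p`, truncated to `[a, b]` and normalised to start at `0`, on the
`D`-neighbourhood of `S`, and the constant `v` off it. -/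
noncomputable def tubeHeight {X : Type*} [MetricSpace X] (S : Set X) (p : X) (D a b v : ℝ)
    (y : X) : ℝ :=
  if infDist y S < D then max a (min b (dist y p)) - a else v

section Tube

variable {X : Type*} [MetricSpace X] {S : Set X} {p : X} {D a b : ℝ}

theorem abs_truncate_sub_le (a b s t : ℝ) :
    |(max a (min b s) - a) - (max a (min b t) - a)| ≤ |s - t| := by
  rw [sub_sub_sub_cancel_right]
  calc |max a (min b s) - max a (min b t)| ≤ |min b s - min b t| := by
        simpa [max_comm a] using abs_max_sub_max_le_abs (min b s) (min b t) a
    _ ≤ |s - t| := by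
        simpa [min_comm b] using abs_min_sub_min_le_max s b t b

theorem abs_tubeHeight_sub_le {v : ℝ} {y z : X} (hy : infDist y S < D) (hz : infDist z S < D) :
    |tubeHeight S p D a b v y - tubeHeight S p D a b v z| ≤ dist y z := by
  simp only [tubeHeight, hy, hz, if_true]
  exact (abs_truncate_sub_le a b _ _).trans (abs_dist_sub_le y z p)

theorem tubeHeight_of_le {v : ℝ} {y : X} (hy : infDist y S < D)
    (h : dist y p ≤ a) : tubeHeight S p D a b v y = 0 := by
  simp [tubeHeight, hy, h]

theorem tubeHeight_of_ge {v : ℝ} {y : X} (hab : a ≤ b) (hy : infDist y S < D)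
    (h : b ≤ dist y p) : tubeHeight S p D a b v y = b - a := by
  simp [tubeHeight, hy, h, hab]

theorem coe_tubeHeight_eq_zero {y : X} (hab : a ≤ b)
    (h : infDist y S < D → dist y p ≤ a ∨ b ≤ dist y p) :
    (tubeHeight S p D a b 0 y : AddCircle (b - a)) = 0 := by
  by_cases hy : infDist y S < D
  · rcases h hy with h | h
    · rw [tubeHeight_of_le hy h, AddCircle.coe_zero]
    · rw [tubeHeight_of_ge hab hy h, AddCircle.coe_period]
  · simp [tubeHeight, hy]

theorem coe_tubeHeight_period (y : X) :
    (tubeHeight S p D a b 0 y : AddCircle (b - a)) = tubeHeight S p D a b (b - a) y := by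
  by_cases hy : infDist y S < D
  · simp [tubeHeight, hy]
  · simp only [tubeHeight, hy, if_false, AddCircle.coe_zero, AddCircle.coe_period]

theorem continuous_coe_tubeHeight (hD : 0 < D) (hab : a ≤ b)
    (hgap : ∀ y z, dist y z < D → infDist y S < D → ¬ infDist z S < D →
      dist y p ≤ a ∨ b ≤ dist y p) :
    Continuous fun y => (tubeHeight S p D a b 0 y : AddCircle (b - a)) := by
  have key : ∀ y z, dist y z < D → ‖(tubeHeight S p D a b 0 y : AddCircle (b - a)) -
      (tubeHeight S p D a b 0 z : AddCircle (b - a))‖ ≤ dist y z := by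
    intro y z hyz
    by_cases hy : infDist y S < D <;> by_cases hz : infDist z S < D
    · rw [← AddCircle.coe_sub]
      exact (QuotientAddGroup.norm_mk_le_norm (S := AddSubgroup.zmultiples (b - a))).trans
        (abs_tubeHeight_sub_le hy hz)
    · rw [coe_tubeHeight_eq_zero hab fun _ => hgap y z hyz hy hz,
        coe_tubeHeight_eq_zero hab fun h => absurd h hz]
      simp
    · rw [coe_tubeHeight_eq_zero hab fun h => absurd h hy,
        coe_tubeHeight_eq_zero hab fun _ => hgap z y (by rwa [dist_comm]) hz hy]
      simp
    · simp [tubeHeight, hy, hz]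
  rw [Metric.continuous_iff]
  intro z ε hε
  refine ⟨min D ε, lt_min hD hε, fun y hy => ?_⟩
  rw [dist_eq_norm]
  exact (key y z (hy.trans_le (min_le_left _ _))).trans_lt (hy.trans_le (min_le_right _ _))

theorem exists_liftReach_tubeHeight_of_dist_lt (hX : IsGeodesicSpace X) (hD : 0 < D)
    (hab : a ≤ b)
    (hgap : ∀ y z, dist y z < D → infDist y S < D → ¬ infDist z S < D →
      dist y p ≤ a ∨ b ≤ dist y p)
    (y z : X) (s : ℝ) (hyz : dist y z < D)
    (hs : (tubeHeight S p D a b 0 y : AddCircle (b - a)) = s) :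
    ∃ t, LiftReach (fun y => (tubeHeight S p D a b 0 y : AddCircle (b - a)))
      (y, s) (z, t) (dist y z) := by
  obtain ⟨σ, hσ, hσ0, hσ1⟩ := hX y z
  by_cases hall : ∀ t ∈ Icc 0 (dist y z), infDist (σ t) S < D
  · have h := liftReach_of_segment (G := fun y => (tubeHeight S p D a b 0 y : AddCircle (b - a)))
      (f := tubeHeight S p D a b 0) hD dist_nonneg hσ (fun _ _ => rfl)
      (fun s hs t ht _ => abs_tubeHeight_sub_le (hall s hs) (hall t ht))
    rw [hσ0, hσ1] at h
    have := h.shift (c := s - tubeHeight S p D a b 0 y)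
      (by rw [AddCircle.coe_sub, hs, sub_self])
    rw [add_sub_cancel] at this
    exact ⟨_, this⟩
  · push Not at hall
    obtain ⟨t₀, ht₀, hfar⟩ := hall
    have hzero : ∀ t ∈ Icc 0 (dist y z),
        (tubeHeight S p D a b 0 (σ t) : AddCircle (b - a)) = 0 := by
      intro t ht
      refine coe_tubeHeight_eq_zero hab fun h => hgap _ (σ t₀) ?_ h (not_lt.2 hfar)
      rw [hσ t ht t₀ ht₀]
      refine lt_of_le_of_lt ?_ hyz
      rw [abs_le]
      constructor <;> linarith [ht.1, ht.2, ht₀.1, ht₀.2]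
    have hs0 : (s : AddCircle (b - a)) = 0 := by
      rw [← hs, ← hσ0]
      exact hzero 0 ⟨le_rfl, dist_nonneg⟩
    have h := liftReach_of_segment (G := fun y => (tubeHeight S p D a b 0 y : AddCircle (b - a)))
      (f := fun _ => s) hD dist_nonneg hσ (fun t ht => by rw [hs0]; exact hzero t ht)
      (fun s _ t _ _ => by simp)
    rw [hσ0, hσ1] at h
    exact ⟨_, h⟩

end Tube

theorem IsSegmentOn.isCompact_image {X : Type*} [MetricSpace X] {l : ℝ → X} {a b : ℝ}
    (hl : IsSegmentOn l a b) : IsCompact (l '' Icc a b) := by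
  refine isCompact_Icc.image_of_continuousOn (LipschitzOnWith.continuousOn (K := 1) ?_)
  exact LipschitzOnWith.of_dist_le_mul fun s hs t ht => by
    rw [hl s hs t ht, Real.dist_eq]; simp

theorem IsSegmentOn.exists_infDist_eq {X : Type*} [MetricSpace X] {l : ℝ → X} {L : ℝ}
    (hL : 0 ≤ L) (hl : IsSegmentOn l 0 L) (x : X) :
    ∃ t ∈ Icc 0 L, dist x (l t) = infDist x (l '' Icc 0 L) := by
  obtain ⟨_, ⟨t, ht, rfl⟩, h⟩ := hl.isCompact_image.exists_infDist_eq_dist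
    ((nonempty_Icc.2 hL).image l) x
  exact ⟨t, ht, h.symm⟩

/-- In a thin space the `D`-neighbourhood of a long segment is isolated from its complement
away from the two ends. -/
theorem IsThinSpace.tube_gap {X : Type*} [MetricSpace X] {R D : ℝ} (hX : IsThinSpace X R D)
    {l : ℝ → X} {L : ℝ} (hL : 2 * R < L) (hl : IsSegmentOn l 0 L) (y z : X)
    (hyz : dist y z < D) (hy : infDist y (l '' Icc 0 L) < D)
    (hz : ¬ infDist z (l '' Icc 0 L) < D) :
    dist y (l 0) ≤ 2 * R ∨ L - 2 * R ≤ dist y (l 0) := by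
  have hR := hX.R_pos
  have hDR := hX.twentyD_le_R
  have hD := hX.D_pos
  obtain ⟨t, ht, hzt⟩ := hl.exists_infDist_eq (by linarith) z
  have hz2 : infDist z (l '' Icc 0 L) < 2 * D := by
    have := infDist_le_infDist_add_dist (s := l '' Icc 0 L) (x := z) (y := y)
    rw [dist_comm z y] at this
    linarith
  have hyt : dist y (l t) < 3 * D := by
    linarith [dist_triangle y z (l t)]
  have ht0 : dist (l t) (l 0) = t := by
    rw [hl t ht 0 ⟨le_rfl, by linarith⟩, sub_zero, abs_of_nonneg ht.1]
  by_cases h1 : t ≤ R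
  · left
    linarith [dist_triangle y (l t) (l 0)]
  · by_cases h2 : t < L - R
    · exact absurd (hX.thin l L hL hl t ⟨lt_of_not_ge h1, h2⟩ z hzt) hz
    · right
      have := dist_triangle (l t) y (l 0)
      rw [dist_comm (l t) y] at this
      linarith

/-- The triangle spanned by the ends of a maximal segment and a point far from it is an
essential loop. -/
theorem IsThinSpace.liftReach_triangle {X : Type*} [MetricSpace X] {R D : ℝ}
    (hX : IsThinSpace X R D) {l : ℝ → X} {Λ : ℝ} (hΛ : 200 * R ≤ Λ) (hl : IsSegmentOn l 0 Λ)
    (hmax : ∀ y z : X, dist y z ≤ Λ)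
    {x : X} (hx : 200 * R ≤ infDist x (l '' Icc 0 Λ)) :
    ∃ ℓ, LiftReach (fun y => (tubeHeight (l '' Icc 0 Λ) (l 0) D (2 * R) (Λ - 2 * R) 0 y :
        AddCircle (Λ - 2 * R - 2 * R)))
      (l 0, 0) (l 0, Λ - 2 * R - 2 * R) ℓ := by
  have hR := hX.R_pos
  have hDR := hX.twentyD_le_R
  have hD := hX.D_pos
  have hab : 2 * R ≤ Λ - 2 * R := by linarith
  have hgap := hX.tube_gap (by linarith) hl
  have h0 : (0 : ℝ) ∈ Icc 0 Λ := ⟨le_rfl, by linarith⟩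
  have h1 : Λ ∈ Icc 0 Λ := ⟨by linarith, le_rfl⟩
  set S := l '' Icc 0 Λ with hS
  set a := 2 * R with ha
  set b := Λ - a with hb
  set G : X → AddCircle (b - a) := fun y => (tubeHeight S (l 0) D a b 0 y : AddCircle (b - a))
  have hin : ∀ t ∈ Icc 0 Λ, infDist (l t) S < D := fun t ht => by
    rwa [infDist_zero_of_mem (mem_image_of_mem l ht)]
  have hxD : ¬ infDist x S < D := by linarith
  have hd01 : dist (l Λ) (l 0) = Λ := by
    rw [hl Λ h1 0 h0, sub_zero, abs_of_nonneg h1.1]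
  have near : ∀ y, infDist y S < D → ∃ t ∈ Icc 0 Λ, dist y (l t) < D ∧
      dist (l t) (l 0) = t ∧ dist (l t) (l Λ) = Λ - t ∧ 200 * R ≤ dist x y + D := by
    intro y hy
    obtain ⟨t, ht, hyt⟩ := hl.exists_infDist_eq h1.1 y
    have hyt' : dist y (l t) < D := hyt.trans_lt hy
    refine ⟨t, ht, hyt', ?_, ?_, ?_⟩
    · rw [hl t ht 0 h0, sub_zero, abs_of_nonneg ht.1]
    · rw [hl t ht Λ h1, abs_sub_comm, abs_of_nonneg (by linarith [ht.2])]
    · have := infDist_le_dist_of_mem (x := x) (mem_image_of_mem l ht)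
      linarith [dist_triangle x y (l t)]
  have mid : ∀ {σ : ℝ → X} {y z : X}, IsSegmentOn σ 0 (dist y z) → σ 0 = y → σ (dist y z) = z →
      ∀ t ∈ Icc 0 (dist y z), dist y (σ t) + dist (σ t) z = dist y z := by
    intro σ y z hσ hσ0 hσ1 t ht
    have e1 := hσ 0 ⟨le_rfl, dist_nonneg⟩ t ht
    have e2 := hσ t ht (dist y z) ⟨dist_nonneg, le_rfl⟩
    rw [hσ0, zero_sub, abs_neg, abs_of_nonneg ht.1] at e1
    rw [hσ1, abs_sub_comm, abs_of_nonneg (by linarith [ht.2])] at e2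
    linarith
  have r1 : LiftReach G (l 0, 0) (l Λ, b - a) Λ := by
    have := liftReach_of_segment (G := G) (f := tubeHeight S (l 0) D a b 0) hD h1.1 hl
      (fun _ _ => rfl) (fun s hs t ht _ => abs_tubeHeight_sub_le (hin s hs) (hin t ht))
    rwa [tubeHeight_of_le (hin 0 h0) (by rw [dist_self]; linarith),
      tubeHeight_of_ge hab (hin Λ h1) (by linarith)] at this
  have r2 : LiftReach G (l Λ, b - a) (x, b - a) (dist (l Λ) x) := by
    obtain ⟨σ, hσ, hσ0, hσ1⟩ := hX.geodesic (l Λ) x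
    have avoid : ∀ t ∈ Icc 0 (dist (l Λ) x), infDist (σ t) S < D → a < dist (σ t) (l 0) := by
      intro t ht hσt
      by_contra! hle
      obtain ⟨u, hu, hu1, hu2, hu3, hu4⟩ := near _ hσt
      have e := mid hσ hσ0 hσ1 t ht
      rw [dist_comm x] at hu4
      have e1 := dist_triangle (l u) (σ t) (l 0)
      have e2 := dist_triangle (l u) (σ t) (l Λ)
      rw [dist_comm (l u) (σ t)] at e1 e2
      rw [dist_comm (σ t) (l Λ)] at e2
      linarith [hmax (l Λ) x]
    have := liftReach_of_segment (G := G) (f := tubeHeight S (l 0) D a b (b - a)) hD dist_nonneg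
      hσ (fun _ _ => coe_tubeHeight_period _) (fun s hs t ht hst => by
        by_cases hy : infDist (σ s) S < D <;> by_cases hz : infDist (σ t) S < D
        · exact abs_tubeHeight_sub_le hy hz
        · have := (hgap _ _ hst hy hz).resolve_left (not_le.2 (avoid s hs hy))
          rw [tubeHeight_of_ge hab hy this]
          simp [tubeHeight, hz]
        · have := (hgap _ _ (by rwa [dist_comm]) hz hy).resolve_left (not_le.2 (avoid t ht hz))
          rw [tubeHeight_of_ge hab hz this]
          simp [tubeHeight, hy]
        · simp [tubeHeight, hy, hz])
    rw [hσ0, hσ1, tubeHeight_of_ge hab (hin Λ h1) (by linarith)] at this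
    simpa [tubeHeight, hxD] using this
  have r3 : LiftReach G (x, 0) (l 0, 0) (dist x (l 0)) := by
    obtain ⟨σ, hσ, hσ0, hσ1⟩ := hX.geodesic x (l 0)
    have avoid : ∀ t ∈ Icc 0 (dist x (l 0)), infDist (σ t) S < D → dist (σ t) (l 0) < b := by
      intro t ht hσt
      by_contra! hle
      obtain ⟨u, hu, hu1, hu2, hu3, hu4⟩ := near _ hσt
      have e := mid hσ hσ0 hσ1 t ht
      linarith [hmax x (l 0)]
    have := liftReach_of_segment (G := G) (f := tubeHeight S (l 0) D a b 0) hD dist_nonneg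
      hσ (fun _ _ => rfl) (fun s hs t ht hst => by
        by_cases hy : infDist (σ s) S < D <;> by_cases hz : infDist (σ t) S < D
        · exact abs_tubeHeight_sub_le hy hz
        · have := (hgap _ _ hst hy hz).resolve_right (not_le.2 (avoid s hs hy))
          rw [tubeHeight_of_le hy this]
          simp [tubeHeight, hz]
        · have := (hgap _ _ (by rwa [dist_comm]) hz hy).resolve_right (not_le.2 (avoid t ht hz))
          rw [tubeHeight_of_le hz this]
          simp [tubeHeight, hy]
        · simp [tubeHeight, hy, hz])
    rw [hσ0, hσ1, tubeHeight_of_le (hin 0 h0) (by rw [dist_self]; linarith)] at this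
    simpa [tubeHeight, hxD] using this
  have r4 := r3.shift (AddCircle.coe_period (b - a))
  simp only [zero_add] at r4
  exact ⟨_, (r1.trans r2).trans r4⟩

/-- A lifted path whose height varies by at least `κ` meets every fibre of `G`. -/
theorem IsLiftedPath.exists_eq_coe {X : Type*} [MetricSpace X] {κ : ℝ} {G : X → AddCircle κ}
    (hκ : 0 < κ) {Γ : ℝ → X × ℝ} {K : ℝ} (hK : 0 ≤ K) (hΓ : IsLiftedPath G Γ K)
    (hge : κ ≤ |(Γ 0).2 - (Γ K).2|) (τ : ℝ) :
    ∃ t ∈ Icc 0 K, G (Γ t).1 = (τ : AddCircle κ) := by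
  have hcont : ContinuousOn (fun t => (Γ t).2) (uIcc 0 K) := by
    rw [uIcc_of_le hK]
    refine LipschitzOnWith.continuousOn (K := 1) (LipschitzOnWith.of_dist_le_mul ?_)
    intro s hs t ht
    wlog hst : s ≤ t generalizing s t
    · rw [dist_comm, dist_comm s t]
      exact this t ht s hs (le_of_not_ge hst)
    have := hΓ.dist_le s t hs.1 hst ht.2
    rw [Prod.dist_eq] at this
    rw [NNReal.coe_one, one_mul, Real.dist_eq s t, abs_sub_comm, abs_of_nonneg (by linarith)]
    exact (le_max_right _ _).trans this
  obtain ⟨n, hn, -⟩ := existsUnique_add_zsmul_mem_Ico hκ τ (min (Γ 0).2 (Γ K).2)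
  have hmem : τ + n • κ ∈ uIcc (Γ 0).2 (Γ K).2 := by
    refine ⟨hn.1, hn.2.le.trans ?_⟩
    have := max_sub_min_eq_abs (Γ 0).2 (Γ K).2
    rw [abs_sub_comm] at this
    linarith
  obtain ⟨t, ht, hte⟩ := intermediate_value_uIcc hcont hmem
  rw [uIcc_of_le hK] at ht
  refine ⟨t, ht, ?_⟩
  simp only at hte
  rw [hΓ.lift t ht.1 ht.2, hte, AddCircle.coe_add, (AddCircle.coe_eq_zero_iff κ).2 ⟨n, rfl⟩,
    add_zero]

theorem dist_eq_of_coe_tubeHeight_eq {X : Type*} [MetricSpace X] {S : Set X} {p : X}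
    {D a b τ : ℝ} (hab : a ≤ b) {y : X} (h0 : 0 < τ) (h1 : τ < b - a)
    (h : (tubeHeight S p D a b 0 y : AddCircle (b - a)) = τ) : dist y p = a + τ := by
  have hτ : (τ : AddCircle (b - a)) ≠ 0 := by
    rw [← AddCircle.coe_zero]
    intro h'
    have := le_abs_sub_of_coe_eq (by linarith) h' h0.ne'
    rw [sub_zero, abs_of_pos h0] at this
    linarith
  have hy : infDist y S < D := by
    by_contra hy
    exact hτ (h ▸ coe_tubeHeight_eq_zero hab fun h' => absurd h' hy)
  have hn : a < dist y p ∧ dist y p < b := by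
    by_contra! hn
    refine hτ (h ▸ coe_tubeHeight_eq_zero hab fun _ => ?_)
    by_cases h2 : a < dist y p
    · exact Or.inr (hn h2)
    · exact Or.inl (not_lt.1 h2)
  have e : tubeHeight S p D a b 0 y = dist y p - a := by
    simp [tubeHeight, hy, hn.1.le, hn.2.le]
  rw [e] at h
  by_contra hne
  have := le_abs_sub_of_coe_eq (by linarith) h (fun h' => hne (by linarith))
  rcases abs_cases (dist y p - a - τ) with h' | h' <;> linarith [hn.1, hn.2]

/-- Proposition 4.16: let `X` be a compact `(R,D)`-thin space, `l` a
segment of maximal length `Λ ≥ 200R`. If `X` is not contained in the `200R`-neighbourhood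
of `l`, then there are `L ≥ 50R` and a distance-preserving map `φ` from the circle of
circumference `2πL` into `X` such that `X` is contained in the `D`-neighbourhood of the
image of `φ`. -/
theorem thin_compact_not_near_segment_isometric_circle
    {X : Type*} [MetricSpace X] {R D : ℝ} (hX : IsThinSpace X R D)
    (hcpt : IsCompact (Set.univ : Set X))
    {l : ℝ → X} {Λ : ℝ} (hΛ : 200 * R ≤ Λ) (hl : IsSegmentOn l 0 Λ)
    (hmax : ∀ (f : ℝ → X) (a b : ℝ), a ≤ b → IsSegmentOn f a b → b - a ≤ Λ)
    (hfar : ∃ x : X, 200 * R ≤ Metric.infDist x (l '' Set.Icc 0 Λ)) :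
    ∃ L : ℝ, 50 * R ≤ L ∧
      ∃ φ : AddCircle (2 * Real.pi * L) → X, Isometry φ ∧
        ∀ x : X, Metric.infDist x (Set.range φ) < D := by
  have hR := hX.R_pos
  have hD := hX.D_pos
  have : CompactSpace X := ⟨hcpt⟩
  have hdist : ∀ y z : X, dist y z ≤ Λ := by
    intro y z
    obtain ⟨f, hf, -, -⟩ := hX.geodesic y z
    simpa using hmax f 0 (dist y z) dist_nonneg hf
  obtain ⟨x, hx⟩ := hfar
  have hgap := hX.tube_gap (by linarith) hl
  have hab : 2 * R ≤ Λ - 2 * R := by linarith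
  have hκ : 0 < Λ - 2 * R - 2 * R := by linarith
  obtain ⟨ℓ, hℓ⟩ := hX.liftReach_triangle hΛ hl hdist hx
  obtain ⟨K, Γ, hK, hΓ, h0, hge, hmin⟩ := exists_shortest_essential_loop hκ
    (continuous_coe_tubeHeight hD hab hgap) hℓ rfl hκ.ne
  have hne : (Γ 0).2 ≠ (Γ K).2 := by
    intro h
    rw [h, sub_self, abs_zero] at hge
    linarith
  have hiso : ∀ a b, 0 ≤ a → a ≤ b → b ≤ K →
      dist (Γ a).1 (Γ b).1 = min (b - a) (K - (b - a)) := fun a b ha hb hbK =>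
    dist_eq_of_shortest_essential_loop
      (exists_liftReach_of_local hX.geodesic hD
        (exists_liftReach_tubeHeight_of_dist_lt hX.geodesic hD hab hgap))
      hΓ h0 hne hmin ha hb hbK
  have hhalf : ∀ s ∈ Icc 0 K, ∀ t ∈ Icc 0 K, dist (Γ s).1 (Γ t).1 ≤ K / 2 := by
    intro s hs t ht
    wlog hst : s ≤ t generalizing s t
    · rw [dist_comm]
      exact this t ht s hs (le_of_not_ge hst)
    rw [hiso s t hs.1 hst ht.2]
    rcases min_cases (t - s) (K - (t - s)) with h | h <;> linarith [h.1, h.2]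
  have hlong : 388 * R ≤ K := by
    obtain ⟨s, hs, hs'⟩ := hΓ.exists_eq_coe hκ hK.le hge R
    obtain ⟨t, ht, ht'⟩ := hΓ.exists_eq_coe hκ hK.le hge (Λ - 5 * R)
    have e1 := dist_eq_of_coe_tubeHeight_eq hab hR (by linarith) hs'
    have e2 := dist_eq_of_coe_tubeHeight_eq hab (by linarith) (by linarith) ht'
    have := dist_triangle (Γ t).1 (Γ s).1 (l 0)
    linarith [hhalf t ht s hs]
  have hL : 2 * Real.pi * (K / (2 * Real.pi)) = K :=
    mul_div_cancel₀ K (by positivity)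
  refine ⟨K / (2 * Real.pi), ?_, ?_⟩
  · rw [le_div_iff₀ (by positivity)]
    nlinarith [Real.pi_lt_d2]
  · rw [hL]
    obtain ⟨φ, hφ⟩ := exists_isometry_addCircle hK hiso
    exact ⟨φ, hφ, hX.infDist_range_lt (by linarith) hφ⟩
end

section
/- For every R > 0 there exists a constant c(R) > 0 (depending only on R) with the following property: if D > 0 with R ≥ 20D and (X,d) is an (R,D)-thin metric space, then there exist a metric space Y which is either the real line ℝ, a closed interval of ℝ, the half-line [0,∞), or a circle ℝ/Pℤ (P > 0) with the quotient metric, and a continuous map f : X → Y such that diam(f⁻¹(y)) ≤ c(R) for every y ∈ Y. In particular, X has 1-Urysohn width at most c(R). -/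
open Metric Set

namespace IsSegmentOn

variable {X : Type*} [MetricSpace X] {l m : ℝ → X} {a b : ℝ}

theorem continuousOn (h : IsSegmentOn l a b) : ContinuousOn l (Icc a b) := by
  rw [Metric.continuousOn_iff]
  intro t ht ε hε
  refine ⟨ε, hε, fun s hs hst => ?_⟩
  rwa [h s hs t ht, ← Real.dist_eq]

theorem isCompact_image_s16 (h : IsSegmentOn l a b) : IsCompact (l '' Icc a b) :=
  isCompact_Icc.image_of_continuousOn h.continuousOn

theorem mono {a' b' : ℝ} (h : IsSegmentOn l a b) (ha : a ≤ a') (hb : b' ≤ b) :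
    IsSegmentOn l a' b' :=
  fun s hs t ht => h s ⟨ha.trans hs.1, hs.2.trans hb⟩ t ⟨ha.trans ht.1, ht.2.trans hb⟩

theorem exists_dist_eq_infDist (h : IsSegmentOn l a b) (hab : a ≤ b) (x : X) :
    ∃ t ∈ Icc a b, dist x (l t) = infDist x (l '' Icc a b) := by
  obtain ⟨_, ⟨t, ht, rfl⟩, hy⟩ := h.isCompact_image_s16.exists_infDist_eq_dist
    ((nonempty_Icc.2 hab).image l) x
  exact ⟨t, ht, hy.symm⟩

/-- Two segments whose lengths add up to the distance between the outer endpoints concatenate. -/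
theorem concat (hl : IsSegmentOn l 0 a) (hm : IsSegmentOn m 0 b) (ha : 0 ≤ a) (hb : 0 ≤ b)
    (hlm : l a = m 0) (hd : a + b ≤ dist (l 0) (m b)) :
    IsSegmentOn (fun t => if t ≤ a then l t else m (t - a)) 0 (a + b) := by
  have key : ∀ s ∈ Icc 0 a, ∀ t ∈ Icc 0 b, dist (l s) (m t) = a + t - s := by
    intro s hs t ht
    have h1 := hl 0 ⟨le_rfl, ha⟩ s hs
    have h2 := hm t ht b ⟨hb, le_rfl⟩
    have h3 := hl s hs a ⟨ha, le_rfl⟩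
    have h4 := hm 0 ⟨le_rfl, hb⟩ t ht
    rw [abs_of_nonpos (by linarith [hs.1])] at h1
    rw [abs_of_nonpos (by linarith [ht.2])] at h2
    rw [abs_of_nonpos (by linarith [hs.2])] at h3
    rw [abs_of_nonpos (by linarith [ht.1])] at h4
    have h5 := dist_triangle4 (l 0) (l s) (m t) (m b)
    have h6 := dist_triangle (l s) (l a) (m t)
    rw [hlm] at h6 h3
    linarith
  intro s hs t ht
  by_cases hsa : s ≤ a <;> by_cases hta : t ≤ a <;> simp only [hsa, hta, if_true, if_false]
  · exact hl s ⟨hs.1, hsa⟩ t ⟨ht.1, hta⟩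
  · rw [key s ⟨hs.1, hsa⟩ (t - a) ⟨by linarith, by linarith [ht.2]⟩, abs_of_nonpos (by linarith)]
    ring
  · rw [dist_comm, key t ⟨ht.1, hta⟩ (s - a) ⟨by linarith, by linarith [hs.2]⟩,
      abs_of_nonneg (by linarith)]
    ring
  · rw [hm (s - a) ⟨by linarith, by linarith [hs.2]⟩ (t - a) ⟨by linarith, by linarith [ht.2]⟩]
    congr 1
    ring

end IsSegmentOn

/-- The points `x` joined to `q` by a segment whose point at distance `S` from `q` is within `E`
of `w`. -/
def sideSet {X : Type*} [MetricSpace X] (q w : X) (S E : ℝ) : Set X :=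
  {x | ∃ z, dist q z = S ∧ S + dist z x = dist q x ∧ dist z w ≤ E}

section sideSet

variable {X : Type*} [MetricSpace X] {q w x : X} {S E : ℝ}

theorem isClosed_sideSet [ProperSpace X] (q w : X) (S E : ℝ) : IsClosed (sideSet q w S E) := by
  have hK : CompactSpace (closedBall w E) := isCompact_iff_compactSpace.1 (isCompact_closedBall w E)
  have hC : IsClosed {p : X × closedBall w E |
      dist q p.2 = S ∧ S + dist (p.2 : X) p.1 = dist q p.1} :=
    (isClosed_eq (by fun_prop) (by fun_prop)).inter (isClosed_eq (by fun_prop) (by fun_prop))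
  convert isClosedMap_fst_of_compactSpace _ hC
  ext x
  constructor
  · rintro ⟨z, h1, h2, h3⟩
    exact ⟨(x, ⟨z, h3⟩), ⟨h1, h2⟩, rfl⟩
  · rintro ⟨⟨_, z, h3⟩, ⟨h1, h2⟩, rfl⟩
    exact ⟨z, h1, h2, h3⟩

theorem le_dist_of_mem_sideSet (hx : x ∈ sideSet q w S E) : S ≤ dist q x := by
  obtain ⟨z, -, h, -⟩ := hx
  linarith [dist_nonneg (x := z) (y := x)]

theorem mem_sideSet_of_isSegmentOn {γ : ℝ → X} {a s : ℝ} (hγ : IsSegmentOn γ 0 a) (h0 : γ 0 = q)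
    (hS : 0 ≤ S) (hs : S ≤ s) (hsa : s ≤ a) (hw : dist (γ S) w ≤ E) :
    γ s ∈ sideSet q w S E := by
  refine ⟨γ S, ?_, ?_, hw⟩
  · rw [← h0, hγ 0 ⟨le_rfl, by linarith⟩ S ⟨hS, by linarith⟩, abs_of_nonpos (by linarith)]
    ring
  · rw [← h0, hγ 0 ⟨le_rfl, by linarith⟩ s ⟨by linarith, by linarith⟩,
      hγ S ⟨by linarith, by linarith⟩ s ⟨by linarith, by linarith⟩, abs_of_nonpos (by linarith),
      abs_of_nonpos (by linarith)]
    ring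

theorem exists_isSegmentOn_of_mem_sideSet (hg : IsGeodesicSpace X) (hx : x ∈ sideSet q w S E) :
    ∃ γ : ℝ → X, IsSegmentOn γ 0 (dist q x) ∧ γ 0 = q ∧ γ (dist q x) = x ∧ dist (γ S) w ≤ E := by
  obtain ⟨z, h1, h2, h3⟩ := hx
  obtain ⟨γ, hγ, hγ0, hγ1⟩ := hg q z
  obtain ⟨η, hη, hη0, hη1⟩ := hg z x
  rw [h1] at hγ hγ1
  have hS : 0 ≤ S := h1 ▸ dist_nonneg
  have hc := hγ.concat hη hS dist_nonneg (hγ1.trans hη0.symm) (by rw [hγ0, hη1, h2])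
  rw [h2] at hc
  refine ⟨_, hc, by simp [hS, hγ0], ?_, by simpa [hγ1] using h3⟩
  have hd : dist q x - S = dist z x := by linarith
  by_cases h : dist q x ≤ S
  · have : dist z x = 0 := le_antisymm (by linarith) dist_nonneg
    simp only [h, if_true]
    rw [← dist_eq_zero.1 this, h1, hγ1]
  · simp only [h, if_false, hd, hη1]

end sideSet

namespace IsThinSpace

variable {X : Type*} [MetricSpace X] {R D : ℝ} {q w w' x y : X}

/-- A path whose projections, as long as it is `D`-close to a segment, avoid the ends of that
segment stays `D`-close to it. -/
theorem infDist_lt_of_isPreconnected (h : IsThinSpace X R D) {l γ : ℝ → X} {L : ℝ} {J : Set ℝ}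
    (hL : 2 * R < L) (hl : IsSegmentOn l 0 L) (hJ : IsPreconnected J) (hγ : ContinuousOn γ J)
    (hproj : ∀ s ∈ J, ∀ t ∈ Icc 0 L, dist (γ s) (l t) ≤ D → t ∈ Ioo R (L - R))
    {s₀ : ℝ} (hs₀ : s₀ ∈ J) (h₀ : infDist (γ s₀) (l '' Icc 0 L) < D) {s : ℝ} (hs : s ∈ J) :
    infDist (γ s) (l '' Icc 0 L) < D := by
  by_contra! hD
  obtain ⟨u, hu, hu'⟩ := hJ.intermediate_value hs₀ hs
    ((continuous_infDist_pt (l '' Icc 0 L)).comp_continuousOn hγ) ⟨h₀.le, hD⟩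
  obtain ⟨t, ht, htu⟩ := hl.exists_dist_eq_infDist (by linarith [h.R_pos]) (γ u)
  simp only [Function.comp_apply] at hu'
  exact (h.thin l L hL hl t (hproj u hu t ht (by linarith)) (γ u) htu).ne hu'

theorem dist_lt_of_dist_le (h : IsThinSpace X R D) {γ η : ℝ → X} {a b E s₀ s : ℝ}
    (hγ : IsSegmentOn γ 0 a) (hη : IsSegmentOn η 0 b) (h0 : γ 0 = η 0) (hE : dist (γ s₀) (η s₀) ≤ E)
    (hDE : D ≤ E) (hs₀ : R + E < s₀) (hs₀a : s₀ < a - R - E) (hs₀b : s₀ ≤ b) (hs : R + D < s)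
    (hsa : s < a - R - D) (hsb : s ≤ b) :
    dist (γ s) (η s) < 2 * D := by
  have hR := h.R_pos
  have hD := h.D_pos
  have hparam : ∀ u, 0 ≤ u → u ≤ b → ∀ t ∈ Icc 0 a, |t - u| ≤ dist (η u) (γ t) := by
    intro u hu hub t ht
    have h1 := hγ 0 ⟨le_rfl, by linarith⟩ t ht
    have h2 := hη 0 ⟨le_rfl, by linarith⟩ u ⟨hu, hub⟩
    rw [abs_of_nonpos (by linarith [ht.1])] at h1
    rw [abs_of_nonpos (by linarith)] at h2
    rw [← h0] at h2
    have h3 := dist_triangle (γ 0) (η u) (γ t)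
    have h4 := dist_triangle (γ 0) (γ t) (η u)
    rw [dist_comm (γ t)] at h4
    exact abs_le.2 ⟨by linarith, by linarith⟩
  have hlt₀ : infDist (η s₀) (γ '' Icc 0 a) < D := by
    obtain ⟨t, ht, hteq⟩ := hγ.exists_dist_eq_infDist (by linarith) (η s₀)
    have h1 := hparam s₀ (by linarith) hs₀b t ht
    have h2 : infDist (η s₀) (γ '' Icc 0 a) ≤ dist (η s₀) (γ s₀) :=
      infDist_le_dist_of_mem ⟨s₀, ⟨by linarith, by linarith⟩, rfl⟩
    rw [dist_comm (η s₀) (γ s₀)] at h2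
    have h3 := abs_le.1 (h1.trans (by linarith : _ ≤ E))
    exact h.thin γ a (by linarith) hγ t ⟨by linarith, by linarith⟩ _ hteq
  have hlt : infDist (η s) (γ '' Icc 0 a) < D := by
    refine h.infDist_lt_of_isPreconnected (J := Ioo (R + D) (a - R - D) ∩ Iic b) (by linarith) hγ
      (ordConnected_Ioo.inter ordConnected_Iic).isPreconnected
      (hη.continuousOn.mono fun u hu => ⟨by linarith [hu.1.1], hu.2⟩) ?_
      ⟨⟨by linarith, by linarith⟩, hs₀b⟩ hlt₀ ⟨⟨hs, hsa⟩, hsb⟩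
    intro u hu t ht hut
    have h3 := abs_le.1 ((hparam u (by linarith [hu.1.1]) hu.2 t ht).trans hut)
    exact ⟨by linarith [hu.1.1], by linarith [hu.1.2]⟩
  obtain ⟨t, ht, hteq⟩ := hγ.exists_dist_eq_infDist (by linarith) (η s)
  have h1 := hparam s (by linarith) hsb t ht
  have h2 := hγ s ⟨by linarith, by linarith⟩ t ht
  have h3 := dist_triangle (γ s) (γ t) (η s)
  rw [abs_sub_comm] at h2
  rw [dist_comm (γ t)] at h3
  linarith

theorem dist_le_of_mem_sideSet (h : IsThinSpace X R D) (hx : x ∈ sideSet q w (2 * R) (2 * D))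
    (hy : y ∈ sideSet q w (2 * R) (2 * D)) (hxy : dist q x = dist q y) : dist x y ≤ 8 * R := by
  have hR := h.R_pos
  have hD := h.D_pos
  have hRD := h.twentyD_le_R
  by_cases ha : dist q x ≤ 4 * R
  · have := dist_triangle x q y
    rw [dist_comm x q] at this
    linarith
  obtain ⟨γ, hγ, hγ0, hγ1, hγw⟩ := exists_isSegmentOn_of_mem_sideSet h.geodesic hx
  obtain ⟨η, hη, hη0, hη1, hηw⟩ := exists_isSegmentOn_of_mem_sideSet h.geodesic hy
  rw [← hxy] at hη hη1
  have h1 := h.dist_lt_of_dist_le (E := 4 * D) (s₀ := 2 * R) (s := dist q x - R - 2 * D) hγ hη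
    (hγ0.trans hη0.symm) ((dist_triangle_right _ _ w).trans (by linarith)) (by linarith)
    (by linarith) (by linarith) (by linarith) (by linarith) (by linarith) (by linarith)
  have h2 := hγ _ ⟨dist_nonneg, le_rfl⟩ (dist q x - R - 2 * D) ⟨by linarith, by linarith⟩
  have h3 := hη (dist q x - R - 2 * D) ⟨by linarith, by linarith⟩ _ ⟨dist_nonneg, le_rfl⟩
  rw [abs_of_nonneg (by linarith), hγ1] at h2
  rw [abs_of_nonpos (by linarith), hη1] at h3
  have := dist_triangle4 x (γ (dist q x - R - 2 * D)) (η (dist q x - R - 2 * D)) y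
  linarith

theorem dist_lt_of_mem_sideSet (h : IsThinSpace X R D) {m : ℝ → X}
    (hm : IsSegmentOn m 0 (20 * R)) (hx : x ∈ sideSet (m 0) (m (2 * R)) (2 * R) (2 * D))
    (hxd : dist (m 0) x ≤ 18 * R) : dist x (m (dist (m 0) x)) < 2 * D := by
  have hR := h.R_pos
  have hD := h.D_pos
  have hRD := h.twentyD_le_R
  have hle := le_dist_of_mem_sideSet hx
  obtain ⟨γ, hγ, hγ0, hγ1, hγw⟩ := exists_isSegmentOn_of_mem_sideSet h.geodesic hx
  rw [dist_comm] at hγw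
  have := h.dist_lt_of_dist_le (s := dist (m 0) x) hm hγ hγ0.symm hγw (by linarith)
    (by linarith) (by linarith) hle (by linarith) (by linarith) le_rfl
  rwa [hγ1, dist_comm] at this

theorem mem_sideSet_or_mem_sideSet (h : IsThinSpace X R D) {l : ℝ → X}
    (hl : IsSegmentOn l 0 (40 * R)) (hx : 2 * R ≤ dist (l (20 * R)) x) :
    x ∈ sideSet (l (20 * R)) (l (22 * R)) (2 * R) (2 * D) ∨
      x ∈ sideSet (l (20 * R)) (l (18 * R)) (2 * R) (2 * D) := by
  have hR := h.R_pos
  have hD := h.D_pos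
  have hRD := h.twentyD_le_R
  obtain ⟨γ, hγ, hγ0, hγ1⟩ := h.geodesic (l (20 * R)) x
  set a := dist (l (20 * R)) x with ha
  have hparam : ∀ u, 0 ≤ u → u ≤ a → ∀ t ∈ Icc 0 (40 * R),
      |(|t - 20 * R| - u)| ≤ dist (γ u) (l t) := by
    intro u hu hua t ht
    have h1 := hl t ht (20 * R) ⟨by linarith, by linarith⟩
    have h2 := hγ 0 ⟨le_rfl, by linarith⟩ u ⟨hu, hua⟩
    rw [abs_of_nonpos (by linarith), hγ0] at h2
    have h3 := dist_triangle (l t) (γ u) (l (20 * R))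
    have h4 := dist_triangle (l (20 * R)) (l t) (γ u)
    rw [dist_comm (l t) (γ u), dist_comm (γ u) (l (20 * R))] at h3
    rw [dist_comm (l t) (γ u), dist_comm (l (20 * R)) (l t)] at h4
    exact abs_le.2 ⟨by linarith, by linarith⟩
  have hlt : infDist (γ (2 * R)) (l '' Icc 0 (40 * R)) < D := by
    refine h.infDist_lt_of_isPreconnected (J := Icc 0 (2 * R)) (s₀ := 0) (by linarith) hl
      isPreconnected_Icc (hγ.continuousOn.mono (Icc_subset_Icc le_rfl hx)) ?_
      ⟨le_rfl, by linarith⟩ ?_ ⟨by linarith, le_rfl⟩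
    · intro u hu t ht hut
      have h1 := abs_le.1 ((hparam u hu.1 (hu.2.trans hx) t ht).trans hut)
      have h2 := abs_le.1 (show |t - 20 * R| ≤ 3 * R by linarith [hu.2])
      exact ⟨by linarith, by linarith⟩
    · rw [hγ0, infDist_zero_of_mem (mem_image_of_mem l (mem_Icc.2 ⟨by linarith, by linarith⟩))]
      exact hD
  obtain ⟨t, ht, hteq⟩ := hl.exists_dist_eq_infDist (by linarith) (γ (2 * R))
  have h1 := hparam (2 * R) (by linarith) hx t ht
  rw [hteq] at h1
  have h2 : ∀ v ∈ Icc 0 (40 * R), |t - v| ≤ D →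
      x ∈ sideSet (l (20 * R)) (l v) (2 * R) (2 * D) := by
    intro v hv htv
    rw [← hγ1]
    refine mem_sideSet_of_isSegmentOn hγ hγ0 (by linarith) hx le_rfl ?_
    have h3 := dist_triangle (γ (2 * R)) (l t) (l v)
    rw [hl t ht v hv] at h3
    linarith
  rcases le_total 0 (t - 20 * R) with hc | hc
  · left
    refine h2 _ ⟨by linarith, by linarith⟩ ?_
    rw [abs_of_nonneg hc] at h1
    rw [show t - 22 * R = t - 20 * R - 2 * R by ring]
    linarith
  · right
    refine h2 _ ⟨by linarith, by linarith⟩ ?_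
    rw [abs_of_nonpos hc] at h1
    rw [abs_sub_comm, show 18 * R - t = -(t - 20 * R) - 2 * R by ring]
    linarith

theorem dist_lt_of_mem_sideSet_inter (h : IsThinSpace X R D)
    (hx : x ∈ sideSet q w (2 * R) (2 * D)) (hx' : x ∈ sideSet q w' (2 * R) (2 * D))
    (hw : 4 * R ≤ dist w w') (hxd : 18 * R ≤ dist q x) (hy : y ∈ sideSet q w (2 * R) (2 * D)) :
    dist q y < dist q x + 10 * R := by
  have hR := h.R_pos
  have hD := h.D_pos
  have hRD := h.twentyD_le_R
  by_contra! hyd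
  obtain ⟨γ, hγ, hγ0, hγ1, hγw⟩ := exists_isSegmentOn_of_mem_sideSet h.geodesic hy
  obtain ⟨η, hη, hη0, hη1, hηw⟩ := exists_isSegmentOn_of_mem_sideSet h.geodesic hx'
  have hz := mem_sideSet_of_isSegmentOn hγ hγ0 (by linarith) (s := dist q x) (by linarith)
    (by linarith) hγw
  have hzd : dist q (γ (dist q x)) = dist q x := by
    rw [← hγ0, hγ 0 ⟨le_rfl, dist_nonneg⟩ _ ⟨dist_nonneg, by rw [hγ0]; linarith⟩, zero_sub, abs_neg,
      abs_of_nonneg dist_nonneg]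
  have h1 := h.dist_le_of_mem_sideSet hz hx hzd
  have h2 := h.dist_lt_of_dist_le (E := 8 * R) (s₀ := dist q x) (s := 2 * R) hγ hη
    (hγ0.trans hη0.symm) (by rwa [hη1]) (by linarith) (by linarith) (by linarith) le_rfl
    (by linarith) (by linarith) (by linarith)
  have h3 := dist_triangle4 w (γ (2 * R)) (η (2 * R)) w'
  rw [dist_comm w (γ (2 * R))] at h3
  linarith

theorem dist_le_of_mem_sideSet_inter (h : IsThinSpace X R D)
    (hx : x ∈ sideSet q w (2 * R) (2 * D)) (hx' : x ∈ sideSet q w' (2 * R) (2 * D))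
    (hw : 4 * R ≤ dist w w') (hxd : 18 * R ≤ dist q x) (hy : y ∈ sideSet q w (2 * R) (2 * D))
    (hyd : dist q x ≤ dist q y) : dist x y ≤ 18 * R := by
  have hR := h.R_pos
  have hlt := h.dist_lt_of_mem_sideSet_inter hx hx' hw hxd hy
  obtain ⟨γ, hγ, hγ0, hγ1, hγw⟩ := exists_isSegmentOn_of_mem_sideSet h.geodesic hy
  have hz := mem_sideSet_of_isSegmentOn hγ hγ0 (by linarith) (s := dist q x) (by linarith)
    (by linarith) hγw
  have hzd : dist q (γ (dist q x)) = dist q x := by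
    rw [← hγ0, hγ 0 ⟨le_rfl, dist_nonneg⟩ _ ⟨dist_nonneg, by rwa [hγ0]⟩, zero_sub, abs_neg,
      abs_of_nonneg dist_nonneg]
  have h1 := h.dist_le_of_mem_sideSet hz hx hzd
  have h2 := hγ (dist q x) ⟨dist_nonneg, hyd⟩ _ ⟨dist_nonneg, le_rfl⟩
  rw [hγ1, abs_of_nonpos (by linarith)] at h2
  have h3 := dist_triangle_left x y (γ (dist q x))
  linarith

theorem lt_dist_of_mem_sideSet_inter (h : IsThinSpace X R D) {l : ℝ → X}
    (hl : IsSegmentOn l 0 (40 * R))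
    (hx : x ∈ sideSet (l (20 * R)) (l (22 * R)) (2 * R) (2 * D))
    (hx' : x ∈ sideSet (l (20 * R)) (l (18 * R)) (2 * R) (2 * D)) :
    18 * R < dist (l (20 * R)) x := by
  have hR := h.R_pos
  have hD := h.D_pos
  have hRD := h.twentyD_le_R
  have hle := le_dist_of_mem_sideSet hx
  by_contra! hxd
  have hl₁ : IsSegmentOn (fun t => l (20 * R + t)) 0 (20 * R) := by
    intro s hs t ht
    rw [hl _ ⟨by linarith [hs.1], by linarith [hs.2]⟩ _ ⟨by linarith [ht.1], by linarith [ht.2]⟩]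
    congr 1
    ring
  have hl₂ : IsSegmentOn (fun t => l (20 * R - t)) 0 (20 * R) := by
    intro s hs t ht
    rw [hl _ ⟨by linarith [hs.2], by linarith [hs.1]⟩ _ ⟨by linarith [ht.2], by linarith [ht.1]⟩,
      abs_sub_comm]
    congr 1
    ring
  have h1 := h.dist_lt_of_mem_sideSet (x := x) hl₁
    (by simpa only [add_zero, show 20 * R + 2 * R = 22 * R by ring] using hx)
    (by simpa only [add_zero] using hxd)
  have h2 := h.dist_lt_of_mem_sideSet (x := x) hl₂
    (by simpa only [sub_zero, show 20 * R - 2 * R = 18 * R by ring] using hx')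
    (by simpa only [sub_zero] using hxd)
  simp only [add_zero, sub_zero] at h1 h2
  have h3 := dist_triangle_left (l (20 * R + dist (l (20 * R)) x))
    (l (20 * R - dist (l (20 * R)) x)) x
  rw [hl _ ⟨by linarith, by linarith⟩ _ ⟨by linarith, by linarith⟩,
    abs_of_nonneg (by linarith)] at h3
  linarith

theorem dist_le_of_signed_eq (h : IsThinSpace X R D) {φ : ℝ → ℝ} {s : ℝ} (hφ : ∀ d, 0 ≤ φ d)
    (hφ0 : ∀ d, φ d = 0 ↔ d ≤ 2 * R)
    (hinj : φ (dist q x) = φ (dist q y) → 0 < φ (dist q x) → dist q x = dist q y)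
    (hx : (x ∈ sideSet q w (2 * R) (2 * D) ∪ {z | dist q z ≤ 2 * R} ∧ s = φ (dist q x)) ∨
      (x ∈ sideSet q w' (2 * R) (2 * D) ∪ {z | dist q z ≤ 2 * R} ∧ s = -φ (dist q x)))
    (hy : (y ∈ sideSet q w (2 * R) (2 * D) ∪ {z | dist q z ≤ 2 * R} ∧ s = φ (dist q y)) ∨
      (y ∈ sideSet q w' (2 * R) (2 * D) ∪ {z | dist q z ≤ 2 * R} ∧ s = -φ (dist q y))) :
    dist x y ≤ 8 * R := by
  have hR := h.R_pos
  have hφx := hφ (dist q x)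
  have hφy := hφ (dist q y)
  have habs : φ (dist q x) = φ (dist q y) := by
    rcases hx with ⟨-, hx⟩ | ⟨-, hx⟩ <;> rcases hy with ⟨-, hy⟩ | ⟨-, hy⟩ <;> linarith
  by_cases hdx : dist q x ≤ 2 * R
  · have hdy := (hφ0 _).1 (habs ▸ (hφ0 _).2 hdx)
    linarith [dist_triangle_left x y q]
  have hdy : ¬ dist q y ≤ 2 * R := fun hdy => hdx ((hφ0 _).1 (habs ▸ (hφ0 _).2 hdy))
  have hpos : 0 < φ (dist q x) := lt_of_le_of_ne hφx fun h0 => hdx ((hφ0 _).1 h0.symm)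
  have hd := hinj habs hpos
  rcases hx with ⟨hx | hx, hsx⟩ | ⟨hx | hx, hsx⟩
  · rcases hy with ⟨hy | hy, hsy⟩ | ⟨-, hsy⟩
    · exact h.dist_le_of_mem_sideSet hx hy hd
    · exact absurd hy hdy
    · linarith
  · exact absurd hx hdx
  · rcases hy with ⟨-, hsy⟩ | ⟨hy | hy, hsy⟩
    · linarith
    · exact h.dist_le_of_mem_sideSet hx hy hd
    · exact absurd hy hdy
  · exact absurd hx hdx

end IsThinSpace

/-- Two continuous maps agreeing on the intersection of two closed sets covering the space glue. -/
theorem exists_continuous_eqOn_of_isClosed_cover {X Y : Type*} [TopologicalSpace X]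
    [TopologicalSpace Y] {A B : Set X} (hA : IsClosed A) (hB : IsClosed B) (hAB : A ∪ B = univ)
    {u v : X → Y} (hu : Continuous u) (hv : Continuous v) (huv : EqOn u v (A ∩ B)) :
    ∃ f : X → Y, Continuous f ∧ EqOn f u A ∧ EqOn f v B := by
  classical
  have hfA : EqOn (A.piecewise u v) u A := A.piecewise_eqOn u v
  have hfB : EqOn (A.piecewise u v) v B := by
    intro x hx
    by_cases hxA : x ∈ A
    · rw [hfA hxA, huv ⟨hxA, hx⟩]
    · exact A.piecewise_eqOn_compl u v hxA
  refine ⟨A.piecewise u v, ?_, hfA, hfB⟩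
  rw [← continuousOn_univ, ← hAB]
  exact (hu.continuousOn.congr hfA).union_of_isClosed (hv.continuousOn.congr hfB) hA hB

theorem AddCircle.eq_or_abs_eq_of_coe_eq {P s t : ℝ} (hP : 0 < P)
    (hs : |s| ≤ P / 2) (ht : |t| ≤ P / 2) (h : (s : AddCircle P) = t) :
    s = t ∨ |s| = P / 2 ∧ |t| = P / 2 := by
  rw [← sub_eq_zero, ← AddCircle.coe_sub, AddCircle.coe_eq_zero_iff] at h
  obtain ⟨n, hn⟩ := h
  rw [zsmul_eq_mul] at hn
  have hs' := abs_le.1 hs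
  have ht' := abs_le.1 ht
  rcases lt_trichotomy n 0 with h0 | rfl | h0
  · have : (n : ℝ) ≤ -1 := by exact_mod_cast Int.le_sub_one_of_lt h0
    have : n * P ≤ -1 * P := mul_le_mul_of_nonneg_right this hP.le
    exact .inr ⟨le_antisymm hs (by linarith [neg_le_abs s]),
      le_antisymm ht (by linarith [le_abs_self t])⟩
  · left
    simp only [Int.cast_zero, zero_mul] at hn
    linarith
  · have : (1 : ℝ) ≤ n := by exact_mod_cast h0
    have : 1 * P ≤ n * P := mul_le_mul_of_nonneg_right this hP.le
    exact .inr ⟨le_antisymm hs (by linarith [le_abs_self s]),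
      le_antisymm ht (by linarith [neg_le_abs t])⟩

/-- Corollary 4.19: for every `R > 0` there is `c(R) > 0` such that
every `(R,D)`-thin metric space (with `0 < D`, `20D ≤ R`) admits a continuous map `f`
onto a connected 1-dimensional manifold (the line, a closed interval, the half-line, or a
circle) all of whose fibers have diameter at most `c(R)`; in particular, such a space has
1-Urysohn width at most `c(R)`. -/
theorem thin_space_urysohn_width
    (R : ℝ) (hR : 0 < R) :
    ∃ c : ℝ, 0 < c ∧
      ∀ (D : ℝ), 0 < D → 20 * D ≤ R →
        ∀ (X : Type) (_ : MetricSpace X), IsThinSpace X R D →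
          (∃ f : X → ℝ, Continuous f ∧
              ∀ y : ℝ, EMetric.diam (f ⁻¹' {y}) ≤ ENNReal.ofReal c) ∨
            (∃ a b : ℝ, ∃ f : X → Set.Icc a b, Continuous f ∧
              ∀ y : Set.Icc a b, EMetric.diam (f ⁻¹' {y}) ≤ ENNReal.ofReal c) ∨
            (∃ f : X → Set.Ici (0 : ℝ), Continuous f ∧
              ∀ y : Set.Ici (0 : ℝ), EMetric.diam (f ⁻¹' {y}) ≤ ENNReal.ofReal c) ∨
            (∃ P : ℝ, 0 < P ∧ ∃ f : X → AddCircle P, Continuous f ∧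
              ∀ y : AddCircle P, EMetric.diam (f ⁻¹' {y}) ≤ ENNReal.ofReal c) := by
  refine ⟨40 * R, by linarith, fun D hD hRD X _ h => ?_⟩
  have : ProperSpace X := h.proper
  by_cases hdiam : ∀ x y : X, dist x y ≤ 40 * R
  · exact .inl ⟨fun _ => 0, continuous_const, fun _ =>
      ediam_le_of_forall_dist_le fun x _ y _ => hdiam x y⟩
  push Not at hdiam
  obtain ⟨p, p', hp⟩ := hdiam
  obtain ⟨l, hl, -, -⟩ := h.geodesic p p'
  replace hl : IsSegmentOn l 0 (40 * R) := hl.mono le_rfl hp.le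
  have hsep : 4 * R ≤ dist (l (22 * R)) (l (18 * R)) := by
    rw [hl _ ⟨by linarith, by linarith⟩ _ ⟨by linarith, by linarith⟩, abs_of_nonneg (by linarith)]
    linarith
  have hinter := fun x => h.lt_dist_of_mem_sideSet_inter (x := x) hl
  have hcover := fun x => h.mem_sideSet_or_mem_sideSet (x := x) hl
  generalize l (20 * R) = q at hinter hcover
  generalize l (22 * R) = w at hsep hinter hcover
  generalize l (18 * R) = w' at hsep hinter hcover
  have hball : IsClosed {z | dist q z ≤ 2 * R} := isClosed_le (by fun_prop) continuous_const
  have hA := isClosed_sideSet q w (2 * R) (2 * D)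
  have hB := isClosed_sideSet q w' (2 * R) (2 * D)
  have huniv : (sideSet q w (2 * R) (2 * D) ∪ {z | dist q z ≤ 2 * R}) ∪
      (sideSet q w' (2 * R) (2 * D) ∪ {z | dist q z ≤ 2 * R}) = univ := by
    refine eq_univ_of_forall fun x => ?_
    rcases le_total (dist q x) (2 * R) with hx | hx
    · exact .inl (.inr hx)
    · exact (hcover x hx).imp .inl .inl
  rcases (sideSet q w (2 * R) (2 * D) ∩ sideSet q w' (2 * R) (2 * D)).eq_empty_or_nonempty
    with hemp | hne
  · left
    have hφ0 : ∀ d, max 0 (d - 2 * R) = 0 ↔ d ≤ 2 * R := fun d => by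
      rw [max_eq_left_iff, sub_nonpos]
    obtain ⟨f, hf, hfA, hfB⟩ := exists_continuous_eqOn_of_isClosed_cover (hA.union hball)
      (hB.union hball) huniv (u := fun x => max 0 (dist q x - 2 * R))
      (v := fun x => -max 0 (dist q x - 2 * R)) (by fun_prop) (by fun_prop) (by
        rw [← inter_union_distrib_right, hemp, empty_union]
        intro x hx
        simp only [(hφ0 _).2 hx, neg_zero])
    have hval : ∀ x, _ ∨ _ := fun x => (huniv.ge (mem_univ x)).imp
      (fun hx => And.intro hx (hfA hx)) (fun hx => And.intro hx (hfB hx))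
    refine ⟨f, hf, fun s => ediam_le_of_forall_dist_le fun x hx y hy => ?_⟩
    have hx' := hval x
    have hy' := hval y
    rw [mem_preimage.1 hx] at hx'
    rw [mem_preimage.1 hy] at hy'
    refine (h.dist_le_of_signed_eq (φ := fun d => max 0 (d - 2 * R)) (fun d => le_max_left _ _) hφ0
      (fun heq hpos => ?_) hx' hy').trans (by linarith)
    rw [heq] at hpos
    have h1 := max_eq_right ((lt_max_iff.1 hpos).resolve_left (lt_irrefl _)).le
    rw [← heq] at hpos
    have h2 := max_eq_right ((lt_max_iff.1 hpos).resolve_left (lt_irrefl _)).le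
    linarith
  · right; right; right
    obtain ⟨x₀, ⟨hx₀, hx₀'⟩, hmin⟩ := (hA.inter hB).exists_infDist_eq_dist hne q
    have hmin' : ∀ x ∈ sideSet q w (2 * R) (2 * D) ∩ sideSet q w' (2 * R) (2 * D),
        dist q x₀ ≤ dist q x := fun x hx => hmin ▸ infDist_le_dist_of_mem hx
    have hρ := hinter x₀ hx₀ hx₀'
    have hfar : ∀ y, dist q x₀ ≤ dist q y → dist x₀ y ≤ 18 * R := by
      intro y hy
      rcases hcover y (by linarith) with hyw | hyw
      · exact h.dist_le_of_mem_sideSet_inter hx₀ hx₀' hsep hρ.le hyw hy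
      · exact h.dist_le_of_mem_sideSet_inter hx₀' hx₀ (by rwa [dist_comm]) hρ.le hyw hy
    set ρ := dist q x₀
    set φ : ℝ → ℝ := fun d => max 0 (min d ρ - 2 * R) with hφ
    have hφnonneg : ∀ d, 0 ≤ φ d := fun d => le_max_left _ _
    have hφle : ∀ d, φ d ≤ ρ - 2 * R := fun d =>
      max_le (by linarith) (by linarith [min_le_right d ρ])
    have hφ0 : ∀ d, φ d = 0 ↔ d ≤ 2 * R := fun d => by
      rw [hφ, max_eq_left_iff, sub_nonpos, min_le_iff, or_iff_left (by linarith)]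
    have hφρ : ∀ d, ρ ≤ d → φ d = ρ - 2 * R := fun d hd => by
      simp only [hφ, min_eq_right hd]
      exact max_eq_right (by linarith)
    have hφlt : ∀ d, 2 * R ≤ d → d < ρ → φ d = d - 2 * R := fun d hd hdρ => by
      simp only [hφ, min_eq_left hdρ.le]
      exact max_eq_right (by linarith)
    have hφcont : Continuous fun x : X => φ (dist q x) := by fun_prop
    have hP : 0 < 2 * (ρ - 2 * R) := by linarith
    obtain ⟨f, hf, hfA, hfB⟩ := exists_continuous_eqOn_of_isClosed_cover (hA.union hball)
      (hB.union hball) huniv (u := fun x => (φ (dist q x) : AddCircle (2 * (ρ - 2 * R))))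
      (v := fun x => ((-φ (dist q x) : ℝ) : AddCircle (2 * (ρ - 2 * R))))
      ((AddCircle.continuous_mk' _).comp hφcont) ((AddCircle.continuous_mk' _).comp hφcont.neg) (by
        rw [← inter_union_distrib_right]
        rintro x (hx | hx)
        · simp only [hφρ _ (hmin' x hx)]
          rw [← sub_eq_zero, ← AddCircle.coe_sub, AddCircle.coe_eq_zero_iff]
          exact ⟨1, by rw [one_zsmul]; ring⟩
        · simp only [(hφ0 _).2 hx, neg_zero])
    have hval : ∀ x, ∃ s : ℝ, f x = s ∧ |s| = φ (dist q x) ∧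
        (x ∈ sideSet q w (2 * R) (2 * D) ∪ {z | dist q z ≤ 2 * R} ∧ s = φ (dist q x) ∨
          x ∈ sideSet q w' (2 * R) (2 * D) ∪ {z | dist q z ≤ 2 * R} ∧ s = -φ (dist q x)) := fun x =>
      (huniv.ge (mem_univ x)).elim
        (fun hx => ⟨φ (dist q x), hfA hx, abs_of_nonneg (hφnonneg _), .inl (And.intro hx rfl)⟩)
        (fun hx => ⟨-φ (dist q x), hfB hx, by rw [abs_neg, abs_of_nonneg (hφnonneg _)],
          .inr (And.intro hx rfl)⟩)
    refine ⟨_, hP, f, hf, fun c => ediam_le_of_forall_dist_le fun x hx y hy => ?_⟩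
    by_cases hxy : ρ ≤ dist q x ∧ ρ ≤ dist q y
    · linarith [dist_triangle_left x y x₀, hfar x hxy.1, hfar y hxy.2]
    have htop : ∀ d, φ d = ρ - 2 * R → ρ ≤ d := by
      intro d hd
      by_contra! hdρ
      rcases le_total (2 * R) d with h2 | h2
      · linarith [hφlt d h2 hdρ]
      · linarith [(hφ0 d).2 h2]
    have hinj : φ (dist q x) = φ (dist q y) → 0 < φ (dist q x) → dist q x = dist q y := by
      intro heq hpos
      have hx2 : 2 * R ≤ dist q x := by
        by_contra! hlt
        exact hpos.ne' ((hφ0 _).2 hlt.le)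
      have hy2 : 2 * R ≤ dist q y := by
        by_contra! hlt
        exact (heq ▸ hpos).ne' ((hφ0 _).2 hlt.le)
      have hxρ : dist q x < ρ := by
        by_contra! hle
        exact hxy ⟨hle, htop _ (heq ▸ hφρ _ hle)⟩
      have hyρ : dist q y < ρ := by
        by_contra! hle
        exact hxy ⟨htop _ (heq ▸ hφρ _ hle), hle⟩
      linarith [hφlt _ hx2 hxρ, hφlt _ hy2 hyρ]
    obtain ⟨s, hfs, hs, hs'⟩ := hval x
    obtain ⟨t, hft, ht, ht'⟩ := hval y
    have hst : (s : AddCircle (2 * (ρ - 2 * R))) = t := by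
      rw [← hfs, ← hft, mem_preimage.1 hx, mem_preimage.1 hy]
    have hhalf : ∀ d, φ d ≤ 2 * (ρ - 2 * R) / 2 := fun d => by linarith [hφle d]
    rcases AddCircle.eq_or_abs_eq_of_coe_eq hP (hs ▸ hhalf _) (ht ▸ hhalf _) hst with rfl | hmax
    · exact (h.dist_le_of_signed_eq hφnonneg hφ0 hinj hs' ht').trans (by linarith)
    · exact absurd ⟨htop _ (by linarith [hmax.1]), htop _ (by linarith [hmax.2])⟩ hxy
end

section
/- Let (X,d) be a proper geodesic metric space, let C' ≥ 1, and let r : [0,∞) → X be a ray such that dist(x, r([0,∞))) ≤ C' for every x ∈ X. Let t ≥ 0, let a, b ∈ X with d(a, r(0)) ≤ 1 and d(b, r(2t)) ≤ 1, and let l : [0,M] → X be a segment with l(0) = a and l(M) = b. Then the midpoint of l satisfies d(l(M/2), r(t)) ≤ 10C'. -/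
open Metric Set

/-- from the proof of Theorem 5.6: in a proper geodesic space lying in
the `C'`-neighbourhood of a ray `r`, the midpoint of any segment between a point `1`-close
to `r(0)` and a point `1`-close to `r(2t)` is `10C'`-close to `r(t)`. -/
theorem midpoint_of_segment_near_ray_midpoint
    {X : Type*} [MetricSpace X] [ProperSpace X] (hgeo : IsGeodesicSpace X)
    {C' : ℝ} (hC' : 1 ≤ C') {r : ℝ → X} (hr : IsRay r)
    (hcov : ∀ x : X, Metric.infDist x (r '' Set.Ici 0) ≤ C')
    {t : ℝ} (ht : 0 ≤ t) {a b : X} (ha : dist a (r 0) ≤ 1) (hb : dist b (r (2 * t)) ≤ 1)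
    {l : ℝ → X} {M : ℝ} (hM : 0 ≤ M) (hl : IsSegmentOn l 0 M)
    (hl0 : l 0 = a) (hlM : l M = b) :
    dist (l (M / 2)) (r t) ≤ 10 * C' := by
  have hne : (r '' Set.Ici (0 : ℝ)).Nonempty := ⟨r 0, 0, Set.self_mem_Ici, rfl⟩
  obtain ⟨_, ⟨s, hs, rfl⟩, hms⟩ := (Metric.infDist_lt_iff hne).1
    (lt_of_le_of_lt (hcov (l (M / 2))) (lt_add_one C'))
  have hs0 : (0 : ℝ) ≤ s := hs
  have hab : dist a b = M := by
    rw [← hl0, ← hlM, hl 0 ⟨le_rfl, hM⟩ M ⟨hM, le_rfl⟩, zero_sub, abs_neg, abs_of_nonneg hM]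
  have ham : dist a (l (M / 2)) = M / 2 := by
    rw [← hl0, hl 0 ⟨le_rfl, hM⟩ (M / 2) ⟨by linarith, by linarith⟩, zero_sub, abs_neg,
      abs_of_nonneg (by linarith)]
  have hr2t : dist (r 0) (r (2 * t)) = 2 * t := by
    rw [hr 0 (2 * t) le_rfl (by linarith), zero_sub, abs_neg, abs_of_nonneg (by linarith)]
  have hr0s : dist (r 0) (r s) = s := by
    rw [hr 0 s le_rfl hs0, zero_sub, abs_neg, abs_of_nonneg hs0]
  have hM_le := dist_triangle4 a (r 0) (r (2 * t)) b
  have hM_ge := dist_triangle4 (r 0) a b (r (2 * t))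
  have hs_le := dist_triangle4 (r 0) a (l (M / 2)) (r s)
  have hs_ge := dist_triangle4 a (r 0) (r s) (l (M / 2))
  rw [dist_comm (r (2 * t)) b] at hM_le
  rw [dist_comm (r 0) a] at hM_ge hs_le
  rw [dist_comm (r s) (l (M / 2))] at hs_ge
  have hst : dist (r s) (r t) ≤ C' + 3 := by
    rw [hr s t hs0 ht, abs_le]
    constructor <;> linarith
  linarith [dist_triangle (l (M / 2)) (r s) (r t)]
end

section
/- Let (X,d) be a proper metric space, let K > 0, and let r : [0,∞) → X be a ray such that dist(x, r([0,∞))) ≤ K for every x ∈ X. Then for every t ≥ 0 the level set { x ∈ X : d(r(0), x) = t } of the distance function from r(0) has diameter at most 5K. -/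
open Metric Set

/-- If `x` is within distance less than `c` of a ray `r`, then it is within distance less than
`2 * c` of the point of `r` at the same distance from the origin as `x`. -/
theorem IsRay.dist_apply_dist_lt {X : Type*} [PseudoMetricSpace X] {r : ℝ → X} (hr : IsRay r)
    {x : X} {c : ℝ} (hx : Metric.infDist x (r '' Set.Ici 0) < c) :
    dist x (r (dist (r 0) x)) < 2 * c := by
  obtain ⟨_, ⟨s, hs, rfl⟩, hxs⟩ :=
    (Metric.infDist_lt_iff (Set.nonempty_Ici.image r)).1 hx
  have h0s : dist (r 0) (r s) = s := by
    rw [hr 0 s le_rfl hs, zero_sub, abs_neg, abs_of_nonneg hs]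
  have hst : dist (r s) (r (dist (r 0) x)) ≤ dist x (r s) := by
    have h := abs_dist_sub_le (r s) x (r 0)
    rwa [dist_comm (r s) (r 0), dist_comm x (r 0), dist_comm (r s) x, h0s,
      ← hr s _ hs dist_nonneg] at h
  linarith [dist_triangle x (r s) (r (dist (r 0) x))]

/-- from the proof of Corollary 4.19: if a proper metric space is
contained in the `K`-neighbourhood of a ray `r`, then every level set of the distance
function from `r(0)` has diameter at most `5K`. -/
theorem level_sets_of_dist_from_ray_origin_small
    {X : Type*} [MetricSpace X] [ProperSpace X] {K : ℝ} (hK : 0 < K)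
    {r : ℝ → X} (hr : IsRay r)
    (hcov : ∀ x : X, Metric.infDist x (r '' Set.Ici 0) ≤ K) :
    ∀ t : ℝ, 0 ≤ t →
      EMetric.diam {x : X | dist (r 0) x = t} ≤ ENNReal.ofReal (5 * K) := by
  intro t _
  refine Metric.ediam_le fun x hx y hy => ?_
  rw [edist_dist]
  refine ENNReal.ofReal_le_ofReal ?_
  have close : ∀ z : X, dist (r 0) z = t → dist z (r t) < 2 * (5 / 4 * K) := by
    rintro z rfl
    exact hr.dist_apply_dist_lt ((hcov z).trans_lt (by linarith))
  linarith [dist_triangle_right x y (r t), close x hx, close y hy]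
end

section
/- Let (X,d) be an (R,D)-thin metric space which is non-compact and contains no line (there is no isometric map ℝ → X). Then for every ray r : [0,∞) → X there exists a finite constant D' (depending on X and r) such that X is contained in the D'-neighbourhood of r, i.e. sup_{x∈X} dist(x, r([0,∞))) ≤ D' < ∞. -/
open Metric Set

open Filter Topology

/-- The image of a ray is closed. -/
theorem IsRay.isClosed_image {X : Type*} [MetricSpace X] {r : ℝ → X} (hr : IsRay r) :
    IsClosed (r '' Set.Ici 0) := by
  have h : Isometry (fun t : Set.Ici (0 : ℝ) => r t) :=
    Isometry.of_dist_eq fun s t => by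
      rw [hr s t s.2 t.2, Subtype.dist_eq, Real.dist_eq]
  have : CompleteSpace (Set.Ici (0 : ℝ)) := isClosed_Ici.completeSpace_coe
  have h' := h.isClosedEmbedding.isClosed_range
  rwa [Set.image_eq_range]

/-- In a thin space, a point far from a ray projects to an initial piece of the ray. -/
theorem IsThinSpace.exists_dist_ray_eq_infDist {X : Type*} [MetricSpace X] {R D : ℝ}
    (hX : IsThinSpace X R D) {r : ℝ → X} (hr : IsRay r) {x : X}
    (hx : D ≤ infDist x (r '' Set.Ici 0)) :
    ∃ t ∈ Set.Icc 0 R, dist x (r t) = infDist x (r '' Set.Ici 0) := by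
  have := hX.proper
  have hR := hX.R_pos
  obtain ⟨_, ⟨t, ht, rfl⟩, htx⟩ :=
    hr.isClosed_image.exists_infDist_eq_dist ⟨r 0, 0, Set.self_mem_Ici, rfl⟩ x
  rw [Set.mem_Ici] at ht
  refine ⟨t, ⟨ht, ?_⟩, htx.symm⟩
  by_contra! htR
  have hmem : r t ∈ r '' Set.Icc 0 (t + R + 1) := ⟨t, ⟨ht, by linarith⟩, rfl⟩
  have heq : dist x (r t) = infDist x (r '' Set.Icc 0 (t + R + 1)) := by
    refine le_antisymm ?_ (infDist_le_dist_of_mem hmem)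
    rw [← htx]
    exact infDist_le_infDist_of_subset (Set.image_mono Set.Icc_subset_Ici_self) ⟨_, hmem⟩
  have hlt := hX.thin r (t + R + 1) (by linarith)
    (fun a ha b hb => hr a b ha.1 hb.1) t ⟨htR, by linarith⟩ x heq
  linarith

/-- In a thin space, a segment from a point far from a ray to a point of the ray
passes near the origin of the ray. -/
theorem IsThinSpace.exists_dist_segment_le {X : Type*} [MetricSpace X] {R D : ℝ}
    (hX : IsThinSpace X R D) {r : ℝ → X} (hr : IsRay r) {f : ℝ → X} {T s : ℝ}
    (hT : 0 ≤ T) (hs : 0 ≤ s) (hf : IsSegmentOn f 0 T)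
    (hf0 : D ≤ infDist (f 0) (r '' Set.Ici 0)) (hfT : f T = r s) :
    ∃ u ∈ Set.Icc 0 T, dist (f u) (r 0) ≤ R + D := by
  have hcont : ContinuousOn f (Set.Icc 0 T) := by
    refine (LipschitzOnWith.of_dist_le_mul (K := 1) fun a ha b hb => ?_).continuousOn
    rw [hf a ha b hb, Real.dist_eq, NNReal.coe_one, one_mul]
  have hend : infDist (f T) (r '' Set.Ici 0) = 0 := by
    rw [hfT]
    exact infDist_zero_of_mem ⟨s, hs, rfl⟩
  obtain ⟨u, hu, huD⟩ := intermediate_value_Icc' hT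
    ((continuous_infDist_pt (r '' Set.Ici 0)).comp_continuousOn hcont)
    ⟨hend.trans_le hX.D_pos.le, hf0⟩
  simp only [Function.comp_apply] at huD
  obtain ⟨t, ht, htu⟩ := hX.exists_dist_ray_eq_infDist hr huD.ge
  refine ⟨u, hu, ?_⟩
  have h0 := hr t 0 ht.1 le_rfl
  rw [sub_zero, abs_of_nonneg ht.1] at h0
  linarith [dist_triangle (f u) (r t) (r 0), ht.2]

/-- In a proper space, longer and longer segments whose midpoints stay in a bounded set
converge to a line. -/
theorem exists_line_of_segments {X : Type*} [MetricSpace X] [ProperSpace X] (p : X) (C K : ℝ)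
    (h : ∀ n : ℕ, ∃ f : ℝ → X, IsSegmentOn f (-(n - K)) (n - K) ∧ dist (f 0) p ≤ C) :
    ∃ g : ℝ → X, ∀ s t : ℝ, dist (g s) (g t) = |s - t| := by
  choose f hf hp using h
  let U : Ultrafilter ℕ := Ultrafilter.of atTop
  have hU : (U : Filter ℕ) ≤ atTop := Ultrafilter.of_le atTop
  have hev : ∀ t : ℝ, ∀ᶠ n : ℕ in atTop, t ∈ Set.Icc (-(n - K)) (n - K) := fun t => by
    filter_upwards [tendsto_natCast_atTop_atTop.eventually_ge_atTop (|t| + K)] with n hn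
    exact abs_le.mp (by linarith)
  have hlim : ∀ t : ℝ, ∃ y : X, Tendsto (fun n => f n t) U (𝓝 y) := fun t => by
    have hball : ∀ᶠ n : ℕ in U, f n t ∈ closedBall p (|t| + C) := by
      filter_upwards [hU (hev t), hU (hev 0)] with n ht h0
      have hd := hf n t ht 0 h0
      rw [sub_zero] at hd
      rw [mem_closedBall]
      linarith [dist_triangle (f n t) (f n 0) p, hp n]
    obtain ⟨y, -, hy⟩ := (isCompact_closedBall p (|t| + C)).ultrafilter_le_nhds'
      (U.map fun n => f n t) hball
    exact ⟨y, hy⟩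
  choose g hg using hlim
  refine ⟨g, fun s t => tendsto_nhds_unique ((hg s).dist (hg t)) ?_⟩
  refine tendsto_const_nhds.congr' ?_
  filter_upwards [hU (hev s), hU (hev t)] with n hs ht
  exact (hf n s hs t ht).symm

/-- first step of the proof of Proposition 4.11: in a non-compact
`(R,D)`-thin metric space containing no line, for every ray `r` there is a finite
constant `D'` such that the whole space is contained in the `D'`-neighbourhood of `r`. -/
theorem thin_noncompact_no_line_bounded_dist_to_any_ray
    {X : Type*} [MetricSpace X] {R D : ℝ} (hX : IsThinSpace X R D)
    (hnc : ¬ IsCompact (Set.univ : Set X))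
    (hnl : ¬ ∃ f : ℝ → X, ∀ s t : ℝ, dist (f s) (f t) = |s - t|) :
    ∀ r : ℝ → X, IsRay r →
      ∃ D' : ℝ, ∀ x : X, Metric.infDist x (r '' Set.Ici 0) ≤ D' := by
  intro r hr
  by_contra! hfar
  have := hX.proper
  refine hnl (exists_line_of_segments (r 0) (R + D) (R + D) fun n => ?_)
  obtain ⟨x, hx⟩ := hfar (n + D)
  have hn : (0 : ℝ) ≤ n := n.cast_nonneg
  obtain ⟨f, hf, hf0, hfT⟩ := hX.geodesic x (r n)
  obtain ⟨u, hu, hur⟩ := hX.exists_dist_segment_le hr dist_nonneg hn hf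
    (by rw [hf0]; linarith) hfT
  have hleft : n - (R + D) ≤ u := by
    have h1 := hf 0 ⟨le_rfl, dist_nonneg⟩ u hu
    rw [hf0, zero_sub, abs_neg, abs_of_nonneg hu.1] at h1
    have h2 : infDist x (r '' Set.Ici 0) ≤ dist x (r 0) :=
      infDist_le_dist_of_mem ⟨0, Set.self_mem_Ici, rfl⟩
    linarith [dist_triangle x (f u) (r 0), hX.D_pos]
  have hright : n - (R + D) ≤ dist x (r n) - u := by
    have h1 := hf _ ⟨dist_nonneg, le_rfl⟩ u hu
    rw [hfT, abs_of_nonneg (sub_nonneg.mpr hu.2)] at h1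
    have h2 := hr n 0 hn le_rfl
    rw [sub_zero, abs_of_nonneg hn] at h2
    linarith [dist_triangle (r n) (f u) (r 0)]
  refine ⟨fun t => f (u + t), fun s hs t ht => ?_, by simpa using hur⟩
  rw [hf (u + s) ⟨by linarith [hs.1], by linarith [hs.2]⟩
    (u + t) ⟨by linarith [ht.1], by linarith [ht.2]⟩, add_sub_add_left_eq_sub]
end
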